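/- Let γ be a probability measure on ℝ belonging to 𝒯₂. Then the sequence (W^{(n,γ)})_{n∈ℕ} satisfies a large deviation principle with speed n and the quasiconvex good rate function 𝕀ᵃ_γ(w) := inf{Φ_γ*(τ₀,τ₁) : τ₀ > 0, τ₁ ∈ ℝ, τ₀^{−1/2} τ₁ = w}, where Φ_γ(t₀,t₁) := log ∫_ℝ∫_ℝ exp(t₀ z² + t₁ z x) μ₂(dz) γ(dx). -/

import Mathlib

open MeasureTheory Filter Topology Set ProbabilityTheory
open scoped ENNReal NNReal

noncomputable section

namespace LDP

/-- The nonnegative part of an extended real, as an extended nonnegative real. -/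
def erealToENNReal (x : EReal) : ℝ≥0∞ := if x = ⊤ then ⊤ else ENNReal.ofReal x.toReal

/-- Extended (possibly infinite) integral of an `EReal`-valued function:
positive part minus negative part. -/
def eIntegral (ν : Measure ℝ) (f : ℝ → EReal) : EReal :=
  ((∫⁻ u, erealToENNReal (f u) ∂ν : ℝ≥0∞) : EReal)
    - ((∫⁻ u, erealToENNReal (-f u) ∂ν : ℝ≥0∞) : EReal)

/-- `q`-th absolute moment of a measure on `ℝ`. -/
def mom (q : ℝ) (ν : Measure ℝ) : ℝ≥0∞ := ∫⁻ x, ENNReal.ofReal (|x| ^ q) ∂ν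

open Classical in
/-- Relative entropy `H(ν|μ)`. -/
def relEnt (ν μ : Measure ℝ) : EReal :=
  if ν ≪ μ then eIntegral ν (fun x => ENNReal.log (ν.rnDeriv μ x)) else ⊤

/-- The generalized normal distribution `μ_p` on `ℝ`. -/
def muP (p : ℝ) : Measure ℝ :=
  volume.withDensity fun y =>
    ENNReal.ofReal ((2 * p ^ (1/p) * Real.Gamma (1 + 1/p))⁻¹ * Real.exp (-(|y| ^ p) / p))

/-- The uniform probability measure `μ_∞` on `[-1,1]`. -/
def muInf : Measure ℝ := (volume (Icc (-1:ℝ) 1))⁻¹ • volume.restrict (Icc (-1:ℝ) 1)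

/-- Extended-real-valued log moment generating function of a measure on `ℝ`. -/
def logM (γ : Measure ℝ) (t : ℝ) : EReal :=
  ENNReal.log (∫⁻ y, ENNReal.ofReal (Real.exp (t * y)) ∂γ)

/-- The class `𝒯_q` of measures whose log mgf is dominated by `C|t|^{q/(q-1)} + C`. -/
def memT (q : ℝ) (γ : Measure ℝ) : Prop :=
  ∃ C : ℝ, ∀ t : ℝ, logM γ t ≤ ((C * |t| ^ (q/(q-1)) + C : ℝ) : EReal)

/-- Legendre transform of a function of one real variable. -/
def legendre1 (Λ : ℝ → EReal) (τ : ℝ) : EReal := ⨆ t : ℝ, ((t * τ : ℝ) : EReal) - Λ t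

/-- Legendre transform of a function of two real variables. -/
def legendre2 (Λ : ℝ × ℝ → EReal) (τ : ℝ × ℝ) : EReal :=
  ⨆ t : ℝ × ℝ, ((t.1 * τ.1 + t.2 * τ.2 : ℝ) : EReal) - Λ t

/-- Legendre transform of a function of three real variables. -/
def legendre3 (Λ : ℝ × ℝ × ℝ → EReal) (τ : ℝ × ℝ × ℝ) : EReal :=
  ⨆ t : ℝ × ℝ × ℝ, ((t.1 * τ.1 + t.2.1 * τ.2.1 + t.2.2 * τ.2.2 : ℝ) : EReal) - Λ t

/-- `Φ_p(t₀,t₁,t₂) = log ∫∫ exp(t₀ z² + t₁ z y + t₂ |y|^p) μ₂(dz) μ_p(dy)`. -/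
def Phi (p : ℝ) (t : ℝ × ℝ × ℝ) : EReal :=
  ENNReal.log (∫⁻ y, (∫⁻ z,
    ENNReal.ofReal (Real.exp (t.1 * z^2 + t.2.1 * z * y + t.2.2 * |y| ^ p)) ∂(muP 2)) ∂(muP p))

/-- The annealed rate function `𝕀ᵃ_p` for `p ∈ [2,∞)`. -/
def Ia (p : ℝ) (w : ℝ) : EReal :=
  ⨅ τ ∈ {τ : ℝ × ℝ × ℝ | 0 < τ.1 ∧ 0 < τ.2.2 ∧
      τ.1 ^ (-(1:ℝ)/2) * τ.2.1 * τ.2.2 ^ (-(1:ℝ)/p) = w},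
    legendre3 (Phi p) τ

/-- `Λ_p(t₁,t₂) = log ∫ exp(t₁ y + t₂|y|^p) μ_p(dy)`. -/
def LamP (p : ℝ) (t : ℝ × ℝ) : EReal :=
  ENNReal.log (∫⁻ y, ENNReal.ofReal (Real.exp (t.1 * y + t.2 * |y| ^ p)) ∂(muP p))

/-- `Ψ_{p,ν}(t₁,t₂) = ∫ Λ_p(t₁ u, t₂) ν(du)`. -/
def Psi (p : ℝ) (ν : Measure ℝ) (t : ℝ × ℝ) : EReal :=
  eIntegral ν (fun u => LamP p (t.1 * u, t.2))

/-- The quenched rate function `𝕀^q_{p,ν}`. -/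
def Iq (p : ℝ) (ν : Measure ℝ) (w : ℝ) : EReal :=
  ⨅ τ ∈ {τ : ℝ × ℝ | 0 < τ.2 ∧ τ.1 * τ.2 ^ (-(1:ℝ)/p) = w}, legendre2 (Psi p ν) τ

/-- The Cramér-type rate function `𝕀^{cr}_p`. -/
def Icr (p : ℝ) (w : ℝ) : EReal :=
  ⨅ τ ∈ {τ : ℝ × ℝ | 0 < τ.2 ∧ τ.1 * τ.2 ^ (-(1:ℝ)/p) = w}, legendre2 (LamP p) τ

/-- `Φ_γ(t₀,t₁) = log ∫∫ exp(t₀ z² + t₁ z x) μ₂(dz) γ(dx)`. -/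
def Phig (γ : Measure ℝ) (t : ℝ × ℝ) : EReal :=
  ENNReal.log (∫⁻ x, (∫⁻ z,
    ENNReal.ofReal (Real.exp (t.1 * z^2 + t.2 * z * x)) ∂(muP 2)) ∂γ)

/-- The annealed rate function `𝕀ᵃ_γ` for a product measure `γ^{⊗n}`. -/
def Iag (γ : Measure ℝ) (w : ℝ) : EReal :=
  ⨅ τ ∈ {τ : ℝ × ℝ | 0 < τ.1 ∧ τ.1 ^ (-(1:ℝ)/2) * τ.2 = w}, legendre2 (Phig γ) τ

/-- `Ψ_{γ,ν}(t) = ∫ log M_γ(t u) ν(du)`. -/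
def Psig (γ ν : Measure ℝ) (t : ℝ) : EReal := eIntegral ν (fun u => logM γ (t * u))

/-- The quenched rate function `𝕀^q_{γ,ν}` for a product measure. -/
def Iqg (γ ν : Measure ℝ) : ℝ → EReal := legendre1 (Psig γ ν)

/-- `Ψ_{∞,ν}`. -/
def PsiInf (ν : Measure ℝ) : ℝ → EReal := Psig muInf ν

/-- `𝕀^q_{∞,ν}`. -/
def IqInf (ν : Measure ℝ) : ℝ → EReal := legendre1 (PsiInf ν)

/-- `𝕀ᵃ_∞`. -/
def IaInf : ℝ → EReal := Iag muInf

/-- Euclidean inner product on `ℝⁿ`. -/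
def dotp {n : ℕ} (x y : Fin n → ℝ) : ℝ := ∑ i, x i * y i

/-- The unit ℓ^p ball of `ℝⁿ`. -/
def lpBall (n : ℕ) (p : ℝ) : Set (Fin n → ℝ) := {x | ∑ i, |x i| ^ p ≤ 1}

/-- The uniform probability measure on the unit ℓ^p ball. -/
def uniformLpBall (n : ℕ) (p : ℝ) : Measure (Fin n → ℝ) :=
  (volume (lpBall n p))⁻¹ • volume.restrict (lpBall n p)

/-- The unit Euclidean sphere in `ℝⁿ`. -/
def unitSphereSet (n : ℕ) : Set (Fin n → ℝ) := {x | ∑ i, (x i)^2 = 1}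

/-- `μ` is the (unique) rotation-invariant probability measure on the unit sphere `S^{n-1}`. -/
def IsUniformSphere {n : ℕ} (μ : Measure (Fin n → ℝ)) : Prop :=
  IsProbabilityMeasure μ ∧ μ (unitSphereSet n) = 1 ∧
    ∀ O : Matrix.orthogonalGroup (Fin n) ℝ,
      Measure.map (fun x => (O : Matrix (Fin n) (Fin n) ℝ).mulVec x) μ = μ

/-- A large deviation principle with speed `s` and rate function `I`. -/
def IsLDP {Ω : Type*} [MeasurableSpace Ω] (P : Measure Ω)
    (ξ : ℕ → Ω → ℝ) (s : ℕ → ℝ) (I : ℝ → EReal) : Prop :=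
  LowerSemicontinuous I ∧
    ∀ Γ : Set ℝ, MeasurableSet Γ →
      (-(⨅ x ∈ interior Γ, I x) ≤
        atTop.liminf fun n =>
          (((s n)⁻¹ : ℝ) : EReal) * ENNReal.log (P {ω | ξ n ω ∈ interior Γ})) ∧
      ((atTop.limsup fun n =>
          (((s n)⁻¹ : ℝ) : EReal) * ENNReal.log (P {ω | ξ n ω ∈ closure Γ})) ≤
        -(⨅ x ∈ closure Γ, I x))

/-- Goodness of a rate function: compact sublevel sets. -/
def HasCompactSublevels (I : ℝ → EReal) : Prop := ∀ c : ℝ, IsCompact {x | I x ≤ (c : EReal)}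

/-- Quasiconvexity: convex sublevel sets. -/
def QuasiconvexRate (I : ℝ → EReal) : Prop := ∀ c : EReal, Convex ℝ {x | I x ≤ c}

/-- Symmetry: `I(-w) = I(w)`. -/
def SymmetricRate (I : ℝ → EReal) : Prop := ∀ w : ℝ, I (-w) = I w

/-- Convexity of an extended-real-valued rate function. -/
def ConvexRate (I : ℝ → EReal) : Prop :=
  ∀ x y a b : ℝ, 0 ≤ a → 0 ≤ b → a + b = 1 →
    I (a * x + b * y) ≤ (a : EReal) * I x + (b : EReal) * I y

/-- Convexity on a set, for extended-real-valued functions. -/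
def ConvexOnE (s : Set ℝ) (g : ℝ → EReal) : Prop :=
  ∀ x ∈ s, ∀ y ∈ s, ∀ a b : ℝ, 0 ≤ a → 0 ≤ b → a + b = 1 →
    g (a * x + b * y) ≤ (a : EReal) * g x + (b : EReal) * g y

/-- Concavity on a set, for extended-real-valued functions. -/
def ConcaveOnE (s : Set ℝ) (g : ℝ → EReal) : Prop :=
  ∀ x ∈ s, ∀ y ∈ s, ∀ a b : ℝ, 0 ≤ a → 0 ≤ b → a + b = 1 →
    (a : EReal) * g x + (b : EReal) * g y ≤ g (a * x + b * y)

/-- Strict convexity, for extended-real-valued functions. -/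
def StrictConvexE (g : ℝ → EReal) : Prop :=
  ∀ x y : ℝ, x ≠ y → ∀ a b : ℝ, 0 < a → 0 < b → a + b = 1 →
    g (a * x + b * y) < (a : EReal) * g x + (b : EReal) * g y

/-- The property of agreeing with a real affine function on a set. -/
def AffineOnE (s : Set ℝ) (g : ℝ → EReal) : Prop :=
  ∃ m q : ℝ, ∀ t ∈ s, g t = ((m * t + q : ℝ) : EReal)

/-- Empirical measure `L_{n,θ} = (1/n) Σ δ_{√n θ_i}`. -/
def empMeas (n : ℕ) (θn : Fin n → ℝ) : Measure ℝ :=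
  ((n : ℝ≥0∞))⁻¹ • ∑ i : Fin n, Measure.dirac (Real.sqrt n * θn i)

end LDP

open LDP

namespace LDP

lemma muP_two : muP 2 = gaussianReal 0 1 := by
  have hG : Real.Gamma (1 + 1 / 2) = √Real.pi / 2 := by
    rw [add_comm, Real.Gamma_add_one (by norm_num), Real.Gamma_one_half_eq]
    ring
  rw [gaussianReal_of_var_ne_zero _ one_ne_zero, muP]
  congr 1
  ext y
  rw [gaussianPDF, gaussianPDFReal, hG]
  congr 1
  have h2 : (2 : ℝ) ^ (1 / 2 : ℝ) = √2 := (Real.sqrt_eq_rpow 2).symm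
  rw [h2, Real.rpow_two, sq_abs]
  congr 1
  · congr 1
    rw [NNReal.coe_one, mul_one, Real.sqrt_mul (by norm_num)]
    ring
  · simp

/-- Gaussian integral of the exponential of a quadratic polynomial, convergent case. -/
lemma lintegral_exp_quadratic {t b : ℝ} (ha : 0 < 1 - 2 * t) :
    ∫⁻ z, ENNReal.ofReal (Real.exp (t * z ^ 2 + b * z)) ∂(gaussianReal 0 1) =
      ENNReal.ofReal ((√(1 - 2 * t))⁻¹ * Real.exp (b ^ 2 / (2 * (1 - 2 * t)))) := by
  set a := 1 - 2 * t with hadef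
  have ht : t = (1 - a) / 2 := by rw [hadef]; ring
  rw [gaussianReal_of_var_ne_zero _ one_ne_zero,
    lintegral_withDensity_eq_lintegral_mul _ (measurable_gaussianPDF _ _) (by fun_prop)]
  have hv : a⁻¹.toNNReal ≠ 0 := (Real.toNNReal_pos.2 (inv_pos.2 ha)).ne'
  rw [← mul_one (ENNReal.ofReal ((√a)⁻¹ * _)), ← lintegral_gaussianPDF_eq_one (b / a) hv,
    ← lintegral_const_mul _ (measurable_gaussianPDF _ _)]
  congr 1
  ext z
  rw [Pi.mul_apply, gaussianPDF, gaussianPDF, ← ENNReal.ofReal_mul (gaussianPDFReal_nonneg _ _ _),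
    ← ENNReal.ofReal_mul (by positivity)]
  congr 1
  rw [gaussianPDFReal, gaussianPDFReal, Real.coe_toNNReal _ (inv_pos.2 ha).le, NNReal.coe_one, mul_assoc, ← Real.exp_add,
    show (√a)⁻¹ * Real.exp (b ^ 2 / (2 * a)) *
      ((√(2 * Real.pi * a⁻¹))⁻¹ * Real.exp (-(z - b / a) ^ 2 / (2 * a⁻¹))) =
      (√a)⁻¹ * (√(2 * Real.pi * a⁻¹))⁻¹ *
      (Real.exp (b ^ 2 / (2 * a)) * Real.exp (-(z - b / a) ^ 2 / (2 * a⁻¹))) by ring, ← Real.exp_add]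
  congr 1
  · rw [← mul_inv, ← Real.sqrt_mul ha.le]
    congr 2
    field_simp
  · congr 1
    rw [ht]
    field_simp
    ring

/-- Gaussian integral of the exponential of a quadratic polynomial, divergent case. -/
lemma lintegral_exp_quadratic_eq_top {t b : ℝ} (ha : 1 - 2 * t ≤ 0) :
    ∫⁻ z, ENNReal.ofReal (Real.exp (t * z ^ 2 + b * z)) ∂(gaussianReal 0 1) = ⊤ := by
  rw [gaussianReal_of_var_ne_zero _ one_ne_zero,
    lintegral_withDensity_eq_lintegral_mul _ (measurable_gaussianPDF _ _) (by fun_prop)]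
  have key : ∀ S : Set ℝ, MeasurableSet S → volume S = ⊤ → (∀ z ∈ S, 0 ≤ b * z) →
      ∫⁻ z, (gaussianPDF 0 1 * fun z => ENNReal.ofReal (Real.exp (t * z ^ 2 + b * z))) z = ⊤ := by
    intro S hS hvol hb
    have hc : 0 < (√(2 * Real.pi))⁻¹ := by positivity
    refine eq_top_iff.2 (le_trans ?_ (setLIntegral_le_lintegral S _))
    calc ⊤ = ∫⁻ z in S, ENNReal.ofReal ((√(2 * Real.pi))⁻¹) := by
          rw [setLIntegral_const, hvol, ENNReal.mul_top (by simpa using hc)]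
      _ ≤ _ := by
          refine setLIntegral_mono' hS fun z hz => ?_
          rw [Pi.mul_apply, gaussianPDF, ← ENNReal.ofReal_mul (gaussianPDFReal_nonneg _ _ _)]
          apply ENNReal.ofReal_le_ofReal
          rw [gaussianPDFReal, NNReal.coe_one, mul_one, mul_assoc, ← Real.exp_add]
          refine le_mul_of_one_le_right hc.le (Real.one_le_exp ?_)
          nlinarith [hb z hz, sq_nonneg z]
  rcases le_total 0 b with h | h
  · exact key (Ici 0) measurableSet_Ici Real.volume_Ici fun z hz => mul_nonneg h hz
  · exact key (Iic 0) measurableSet_Iic Real.volume_Iic fun z hz => mul_nonneg_of_nonpos_of_nonpos h hz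

/-- The joint Laplace transform of `(z², z x)` under `μ₂ ⊗ κ`. -/
def laplace (κ : Measure ℝ) (t : ℝ × ℝ) : ℝ≥0∞ :=
  ∫⁻ x, (∫⁻ z, ENNReal.ofReal (Real.exp (t.1 * z^2 + t.2 * z * x)) ∂(muP 2)) ∂κ

lemma Phig_eq_log_laplace (γ : Measure ℝ) (t : ℝ × ℝ) : Phig γ t = ENNReal.log (laplace γ t) := rfl

lemma laplace_of_pos (κ : Measure ℝ) {t : ℝ × ℝ} (ha : 0 < 1 - 2 * t.1) :
    laplace κ t = ENNReal.ofReal (√(1 - 2 * t.1))⁻¹ *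
      ∫⁻ x, ENNReal.ofReal (Real.exp (t.2 ^ 2 * x ^ 2 / (2 * (1 - 2 * t.1)))) ∂κ := by
  rw [laplace, ← lintegral_const_mul _ (by fun_prop)]
  congr 1
  ext x
  rw [muP_two, ← ENNReal.ofReal_mul (by positivity), ← mul_pow, ← lintegral_exp_quadratic ha]
  congr 1
  ext z
  ring_nf

lemma laplace_of_nonpos {κ : Measure ℝ} (hκ : κ ≠ 0) {t : ℝ × ℝ} (ha : 1 - 2 * t.1 ≤ 0) :
    laplace κ t = ⊤ := by
  have : ∀ x, ∫⁻ z, ENNReal.ofReal (Real.exp (t.1 * z^2 + t.2 * z * x)) ∂(muP 2) = ⊤ := by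
    intro x
    rw [muP_two, ← lintegral_exp_quadratic_eq_top (b := t.2 * x) ha]
    congr 1
    ext z
    ring_nf
  simp only [laplace, this, lintegral_const]
  exact ENNReal.top_mul (by simpa using hκ)

lemma laplace_mono {κ κ' : Measure ℝ} (h : κ ≤ κ') (t : ℝ × ℝ) : laplace κ t ≤ laplace κ' t :=
  lintegral_mono' h le_rfl

lemma laplace_ne_zero {κ : Measure ℝ} (hκ : κ ≠ 0) (t : ℝ × ℝ) : laplace κ t ≠ 0 := by
  rcases le_or_gt (1 - 2 * t.1) 0 with ha | ha
  · simp [laplace_of_nonpos hκ ha]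
  · rw [laplace_of_pos κ ha]
    refine mul_ne_zero (by simpa using ha) ?_
    intro h
    rw [lintegral_eq_zero_iff (by fun_prop)] at h
    apply hκ
    rw [← ae_eq_bot, ← Filter.eventually_false_iff_eq_bot]
    filter_upwards [h] with x hx
    exact absurd hx (by simp [Real.exp_pos])

lemma laplace_zero (κ : Measure ℝ) : laplace κ 0 = κ univ := by
  rw [laplace, muP_two]
  simp

/-- Under `μ₂ ⊗ γ` with `γ ∈ 𝒯₂`, the product `z x` has small exponential moments. -/
lemma exists_laplace_lt_top {γ : Measure ℝ} [IsProbabilityMeasure γ] (hγ : memT 2 γ) :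
    ∃ s : ℝ, 0 < s ∧ laplace γ (0, s) < ⊤ ∧ laplace γ (0, -s) < ⊤ := by
  obtain ⟨C, hC⟩ := hγ
  have hM : ∀ u : ℝ, ∫⁻ y, ENNReal.ofReal (Real.exp (u * y)) ∂γ ≤
      ENNReal.ofReal (Real.exp (|C| * u ^ 2 + |C|)) := by
    intro u
    rw [← ENNReal.log_le_log_iff, ENNReal.log_ofReal_of_pos (Real.exp_pos _), Real.log_exp]
    refine (hC u).trans (EReal.coe_le_coe_iff.2 ?_)
    rw [show (2 : ℝ) / (2 - 1) = 2 by norm_num, Real.rpow_two, sq_abs]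
    gcongr <;> exact le_abs_self C
  have hs0 : 0 < 1 / (4 * (|C| + 1)) := by positivity
  refine ⟨√(1 / (4 * (|C| + 1))), Real.sqrt_pos.2 hs0, ?_⟩
  set s := √(1 / (4 * (|C| + 1)))
  have hs2 : s ^ 2 * |C| ≤ 1 / 4 := by
    rw [Real.sq_sqrt hs0.le, div_mul_eq_mul_div, div_le_div_iff₀ (by positivity) (by norm_num)]
    linarith [abs_nonneg C]
  have key : ∀ r : ℝ, r ^ 2 = s ^ 2 → laplace γ (0, r) < ⊤ := by
    intro r hr
    rw [laplace, muP_two, lintegral_lintegral_swap (by fun_prop)]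
    calc _ ≤ ∫⁻ z, ENNReal.ofReal (Real.exp |C|) *
            ENNReal.ofReal (Real.exp (1 / 4 * z ^ 2 + 0 * z)) ∂(gaussianReal 0 1) := by
          refine lintegral_mono fun z => ?_
          simp only [zero_mul, zero_add]
          refine (hM (r * z)).trans ?_
          rw [← ENNReal.ofReal_mul (by positivity), ← Real.exp_add]
          refine ENNReal.ofReal_le_ofReal (Real.exp_le_exp.2 ?_)
          rw [mul_pow, hr]
          nlinarith [sq_nonneg z]
      _ < ⊤ := by
          rw [lintegral_const_mul _ (by fun_prop), lintegral_exp_quadratic (by norm_num)]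
          exact ENNReal.mul_lt_top ENNReal.ofReal_lt_top ENNReal.ofReal_lt_top
  exact ⟨key s rfl, key (-s) (by ring)⟩

lemma Phig_eq_coe {γ : Measure ℝ} [IsProbabilityMeasure γ] {t : ℝ × ℝ} (h : laplace γ t < ⊤) :
    Phig γ t = ((Real.log (laplace γ t).toReal : ℝ) : EReal) := by
  rw [Phig_eq_log_laplace, ENNReal.log_pos_real (laplace_ne_zero (NeZero.ne γ) t) h.ne]

lemma Phig_ne_bot (γ : Measure ℝ) [IsProbabilityMeasure γ] (t : ℝ × ℝ) : Phig γ t ≠ ⊥ := by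
  rw [Phig_eq_log_laplace, Ne, ENNReal.log_eq_bot_iff]
  exact laplace_ne_zero (NeZero.ne γ) t

lemma Phig_left {γ : Measure ℝ} [IsProbabilityMeasure γ] {u : ℝ} (hu : 0 < 1 - 2 * u) :
    Phig γ (u, 0) = ((-(Real.log (1 - 2 * u) / 2) : ℝ) : EReal) := by
  rw [Phig_eq_log_laplace, laplace_of_pos γ (t := (u, 0)) hu]
  simp only [ne_eq, OfNat.ofNat_ne_zero, not_false_eq_true, zero_pow, zero_mul, zero_div,
    Real.exp_zero, ENNReal.ofReal_one, lintegral_const, measure_univ, mul_one]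
  rw [ENNReal.log_ofReal_of_pos (by positivity), Real.log_inv, Real.log_sqrt hu.le]

/-- Outside a box bounded away from `{τ₀ = 0}`, the Legendre transform is uniformly large, as
witnessed by finitely many dual points. -/
lemma exists_finset_lt_outside_box {γ : Measure ℝ} [IsProbabilityMeasure γ] (hγ : memT 2 γ)
    (α : ℝ) : ∃ T : Finset (ℝ × ℝ), ∃ ε > (0 : ℝ), ∃ M : ℝ, ∀ τ : ℝ × ℝ,
      (τ.1 < ε ∨ M < τ.1 ∨ M < |τ.2|) →
        ∃ t ∈ T, (α : EReal) < ((t.1 * τ.1 + t.2 * τ.2 : ℝ) : EReal) - Phig γ t := by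
  obtain ⟨s, hs, h1, h2⟩ := exists_laplace_lt_top hγ
  set r₁ := Real.log (laplace γ (0, s)).toReal
  set r₂ := Real.log (laplace γ (0, -s)).toReal
  set r₀ := -(Real.log (1 - 2 * (1 / 4)) / 2) with hr₀
  set N := Real.exp (2 * (α + 1))
  have hN : 0 < N := Real.exp_pos _
  have hlog : 2 * (α + 1) < Real.log (1 - 2 * (-N)) := by
    rw [Real.lt_log_iff_exp_lt (by linarith)]
    change N < _
    linarith
  set M := max (4 * (α + r₀)) (max ((α + r₁) / s) ((α + r₂) / s))
  have hM0 : 4 * (α + r₀) ≤ M := le_max_left _ _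
  have hM1 : α + r₁ ≤ M * s := by
    rw [← div_le_iff₀ hs]; exact (le_max_left _ _).trans (le_max_right _ _)
  have hM2 : α + r₂ ≤ M * s := by
    rw [← div_le_iff₀ hs]; exact (le_max_right _ _).trans (le_max_right _ _)
  refine ⟨{(-N, 0), (1 / 4, 0), (0, s), (0, -s)}, 1 / N, by positivity, M, fun τ hτ => ?_⟩
  rcases hτ with hτ | hτ | hτ
  · refine ⟨(-N, 0), by simp, ?_⟩
    rw [Phig_left (by linarith), ← EReal.coe_sub, EReal.coe_lt_coe_iff]
    have : τ.1 * N < 1 := by rwa [lt_div_iff₀ hN] at hτ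
    simp only
    linarith
  · refine ⟨(1 / 4, 0), by simp, ?_⟩
    rw [Phig_left (by norm_num), ← EReal.coe_sub, EReal.coe_lt_coe_iff, ← hr₀]
    simp only
    linarith
  · rcases lt_abs.1 hτ with hτ | hτ
    · refine ⟨(0, s), by simp, ?_⟩
      rw [Phig_eq_coe h1, ← EReal.coe_sub, EReal.coe_lt_coe_iff]
      change α < 0 * τ.1 + s * τ.2 - r₁
      nlinarith
    · refine ⟨(0, -s), by simp, ?_⟩
      rw [Phig_eq_coe h2, ← EReal.coe_sub, EReal.coe_lt_coe_iff]
      change α < 0 * τ.1 + -s * τ.2 - r₂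
      nlinarith

section Legendre

variable {Λ : ℝ × ℝ → EReal}

lemma le_legendre2 (Λ : ℝ × ℝ → EReal) (t τ : ℝ × ℝ) :
    ((t.1 * τ.1 + t.2 * τ.2 : ℝ) : EReal) - Λ t ≤ legendre2 Λ τ :=
  le_iSup (fun t : ℝ × ℝ => ((t.1 * τ.1 + t.2 * τ.2 : ℝ) : EReal) - Λ t) t

lemma setOf_legendre2_le (Λ : ℝ × ℝ → EReal) (c : EReal) :
    {τ | legendre2 Λ τ ≤ c} =
      ⋂ t : ℝ × ℝ, {τ : ℝ × ℝ | ((t.1 * τ.1 + t.2 * τ.2 : ℝ) : EReal) - Λ t ≤ c} := by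
  ext τ
  simp [legendre2, iSup_le_iff]

lemma isClosed_legendre2_le (hΛ : ∀ t, Λ t ≠ ⊥) (c : EReal) :
    IsClosed {τ | legendre2 Λ τ ≤ c} := by
  rw [setOf_legendre2_le]
  refine isClosed_iInter fun t => ?_
  induction h : Λ t with
  | bot => exact absurd h (hΛ t)
  | top => simp
  | coe r =>
    simp only [← EReal.coe_sub]
    exact isClosed_Iic.preimage (continuous_coe_real_ereal.comp (by fun_prop))

lemma lowerSemicontinuous_legendre2 (hΛ : ∀ t, Λ t ≠ ⊥) : LowerSemicontinuous (legendre2 Λ) :=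
  lowerSemicontinuous_iff_isClosed_preimage.2 (isClosed_legendre2_le hΛ)

lemma convex_legendre2_le (hΛ : ∀ t, Λ t ≠ ⊥) (c : ℝ) :
    Convex ℝ {τ | legendre2 Λ τ ≤ c} := by
  rw [setOf_legendre2_le]
  refine convex_iInter fun t => ?_
  induction h : Λ t with
  | bot => exact absurd h (hΛ t)
  | top => simpa using convex_univ
  | coe r =>
    simp only [← EReal.coe_sub, EReal.coe_le_coe_iff, sub_le_iff_le_add]
    refine convex_halfSpace_le (f := fun τ : ℝ × ℝ => t.1 * τ.1 + t.2 * τ.2) ⟨?_, ?_⟩ _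
    · intro x y; simp; ring
    · intro a x; simp; ring

end Legendre

/-- The map through which the two-dimensional principle is contracted. -/
def contr (τ : ℝ × ℝ) : ℝ := τ.1 ^ (-(1:ℝ)/2) * τ.2

lemma continuousOn_contr : ContinuousOn contr {τ | 0 < τ.1} := by
  refine ContinuousOn.mul (ContinuousOn.rpow_const (by fun_prop) fun τ hτ => Or.inl ?_) (by fun_prop)
  exact (show 0 < τ.1 from hτ).ne'

lemma Iag_contr_le (γ : Measure ℝ) {τ : ℝ × ℝ} (hτ : 0 < τ.1) :
    Iag γ (contr τ) ≤ legendre2 (Phig γ) τ :=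
  iInf₂_le (f := fun τ (_ : τ ∈ {τ : ℝ × ℝ | 0 < τ.1 ∧ τ.1 ^ (-(1:ℝ)/2) * τ.2 = _}) =>
    legendre2 (Phig γ) τ) τ ⟨hτ, rfl⟩

section Sublevels

variable {γ : Measure ℝ} [IsProbabilityMeasure γ]

lemma exists_pos_box (hγ : memT 2 γ) (c : ℝ) : ∃ ε > (0 : ℝ), ∃ M : ℝ,
    {τ | legendre2 (Phig γ) τ ≤ c} ⊆ Icc ε M ×ˢ Icc (-M) M := by
  obtain ⟨T, ε, hε, M, h⟩ := exists_finset_lt_outside_box hγ c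
  refine ⟨ε, hε, M, fun τ hτ => ?_⟩
  by_contra hn
  have : τ.1 < ε ∨ M < τ.1 ∨ M < |τ.2| := by
    by_contra! h'
    exact hn ⟨⟨h'.1, h'.2.1⟩, abs_le.1 h'.2.2⟩
  obtain ⟨t, -, ht⟩ := h τ this
  exact absurd (ht.trans_le (le_legendre2 _ t τ)) (not_lt.2 hτ)

lemma legendre2_le_subset_pos (hγ : memT 2 γ) (c : ℝ) :
    {τ | legendre2 (Phig γ) τ ≤ c} ⊆ {τ | 0 < τ.1} := by
  obtain ⟨ε, hε, M, h⟩ := exists_pos_box hγ c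
  exact fun τ hτ => hε.trans_le (h hτ).1.1

lemma isCompact_legendre2_le (hγ : memT 2 γ) (c : ℝ) :
    IsCompact {τ | legendre2 (Phig γ) τ ≤ c} := by
  obtain ⟨ε, hε, M, h⟩ := exists_pos_box hγ c
  exact (isCompact_Icc.prod isCompact_Icc).of_isClosed_subset
    (isClosed_legendre2_le (Phig_ne_bot γ) _) h

lemma setOf_Iag_le (hγ : memT 2 γ) (c : ℝ) :
    {w | Iag γ w ≤ c} = contr '' {τ | legendre2 (Phig γ) τ ≤ c} := by
  ext w
  constructor
  · intro hw
    set K := {τ | legendre2 (Phig γ) τ ≤ (c + 1 : ℝ)}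
    have hK : IsCompact K := isCompact_legendre2_le hγ (c + 1)
    have hS : IsCompact (K ∩ contr ⁻¹' {w}) :=
      hK.of_isClosed_subset (ContinuousOn.preimage_isClosed_of_isClosed
        (continuousOn_contr.mono (legendre2_le_subset_pos hγ _)) hK.isClosed isClosed_singleton)
        inter_subset_left
    have hne : (K ∩ contr ⁻¹' {w}).Nonempty := by
      have : Iag γ w < ((c + 1 : ℝ) : EReal) :=
        lt_of_le_of_lt hw (EReal.coe_lt_coe_iff.2 (by linarith))
      simp only [Iag, iInf_lt_iff] at this
      obtain ⟨τ, ⟨-, hτ⟩, h⟩ := this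
      exact ⟨τ, h.le, hτ⟩
    obtain ⟨τ, hτ, hmin⟩ := LowerSemicontinuousOn.exists_isMinOn hne hS
      ((lowerSemicontinuous_legendre2 (Phig_ne_bot γ)).lowerSemicontinuousOn _)
    refine ⟨τ, show legendre2 (Phig γ) τ ≤ c from le_trans (le_iInf₂ fun σ hσ => ?_) hw, hτ.2⟩
    by_cases hσK : σ ∈ K
    · exact hmin ⟨hσK, hσ.2⟩
    · exact (show _ ≤ _ from hτ.1).trans (not_le.1 hσK).le
  · rintro ⟨τ, hτ, rfl⟩
    exact (Iag_contr_le γ (legendre2_le_subset_pos hγ c hτ)).trans hτ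

lemma hasCompactSublevels_Iag (hγ : memT 2 γ) : HasCompactSublevels (Iag γ) := by
  intro c
  rw [setOf_Iag_le hγ]
  exact (isCompact_legendre2_le hγ c).image_of_continuousOn
    (continuousOn_contr.mono (legendre2_le_subset_pos hγ c))

lemma setOf_le_bot (I : ℝ → EReal) : {w | I w ≤ ⊥} = ⋂ c : ℝ, {w | I w ≤ (c : EReal)} := by
  ext w
  simp only [mem_ofPred_eq, mem_iInter, le_bot_iff]
  rw [EReal.eq_bot_iff_forall_lt]
  exact ⟨fun h c => (h c).le, fun h c =>
    lt_of_le_of_lt (h (c - 1)) (EReal.coe_lt_coe_iff.2 (by linarith))⟩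

lemma quasiconvexRate_Iag (hγ : memT 2 γ) : QuasiconvexRate (Iag γ) := by
  have hreal : ∀ c : ℝ, Convex ℝ {w | Iag γ w ≤ (c : EReal)} := by
    intro c
    rw [setOf_Iag_le hγ]
    exact ((convex_legendre2_le (Phig_ne_bot γ) c).isPreconnected.image _
      (continuousOn_contr.mono (legendre2_le_subset_pos hγ c))).ordConnected.convex
  intro c
  induction c with
  | bot => rw [setOf_le_bot]; exact convex_iInter hreal
  | top => simpa using convex_univ
  | coe c => exact hreal c

lemma lowerSemicontinuous_Iag (hγ : memT 2 γ) : LowerSemicontinuous (Iag γ) := by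
  have hreal : ∀ c : ℝ, IsClosed {w | Iag γ w ≤ (c : EReal)} := fun c =>
    (hasCompactSublevels_Iag hγ c).isClosed
  rw [lowerSemicontinuous_iff_isClosed_preimage]
  intro c
  change IsClosed {w | Iag γ w ≤ c}
  induction c with
  | bot => rw [setOf_le_bot]; exact isClosed_iInter hreal
  | top => simp
  | coe c => exact hreal c

end Sublevels

section Rotation

open Matrix

variable {n : ℕ}

lemma orthogonal_dotProduct (O : Matrix.orthogonalGroup (Fin n) ℝ) (x y : Fin n → ℝ) :
    ((O : Matrix (Fin n) (Fin n) ℝ) *ᵥ x) ⬝ᵥ ((O : Matrix (Fin n) (Fin n) ℝ) *ᵥ y) = x ⬝ᵥ y := by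
  have h : (O : Matrix (Fin n) (Fin n) ℝ)ᵀ * O = 1 := (Matrix.mem_orthogonalGroup_iff' _ _).1 O.2
  rw [Matrix.dotProduct_mulVec, ← Matrix.mulVec_transpose, Matrix.mulVec_mulVec, h,
    Matrix.one_mulVec]

lemma exists_orthogonal_mulVec_eq {u v : Fin n → ℝ} (h : u ⬝ᵥ u = v ⬝ᵥ v) :
    ∃ O : Matrix.orthogonalGroup (Fin n) ℝ, (O : Matrix (Fin n) (Fin n) ℝ) *ᵥ u = v := by
  by_cases huv : u = v
  · exact ⟨1, by simp [huv]⟩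
  set w := u - v with hw
  have hw0 : w ⬝ᵥ w ≠ 0 := by
    rw [Ne, dotProduct_self_eq_zero]
    exact sub_ne_zero.2 huv
  have hwu : w ⬝ᵥ u = w ⬝ᵥ w / 2 := by
    rw [hw, dotProduct_sub, sub_dotProduct, sub_dotProduct, dotProduct_comm v u, h]
    ring
  set O : Matrix (Fin n) (Fin n) ℝ := 1 - (2 / (w ⬝ᵥ w)) • vecMulVec w w
  have hO : O ∈ Matrix.orthogonalGroup (Fin n) ℝ := by
    rw [Matrix.mem_orthogonalGroup_iff]
    have hT : Oᵀ = O := by simp [O, Matrix.transpose_sub]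
    rw [hT]
    simp only [O, sub_mul, mul_sub, one_mul, mul_one, smul_mul_assoc, mul_smul_comm,
      Matrix.vecMulVec_mul_vecMulVec]
    rw [Matrix.vecMulVec_smul, smul_smul]
    rw [div_mul_cancel₀ _ hw0, two_smul]
    simp only [smul_sub, smul_add]
    abel
  refine ⟨⟨O, hO⟩, ?_⟩
  change O *ᵥ u = v
  simp only [O, Matrix.sub_mulVec, Matrix.one_mulVec, Matrix.smul_mulVec]
  rw [Matrix.vecMulVec_mulVec, hwu]
  have h1 : 2 / (w ⬝ᵥ w) * (w ⬝ᵥ w / 2) = 1 := by field_simp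
  rw [op_smul_eq_smul, smul_smul, h1, one_smul, hw]
  abel

/-- The standard Gaussian measure on `ℝⁿ`. -/
def gaussPi (n : ℕ) : Measure (Fin n → ℝ) := Measure.pi fun _ => gaussianReal 0 1

instance : IsProbabilityMeasure (gaussPi n) := by unfold gaussPi; infer_instance

lemma measurable_mulVec (O : Matrix (Fin n) (Fin n) ℝ) :
    Measurable fun x : Fin n → ℝ => O *ᵥ x := by
  unfold Matrix.mulVec dotProduct
  fun_prop

lemma map_orthogonal_gaussPi (O : Matrix.orthogonalGroup (Fin n) ℝ) :
    (gaussPi n).map (fun x => (O : Matrix (Fin n) (Fin n) ℝ) *ᵥ x) = gaussPi n := by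
  set M : Matrix (Fin n) (Fin n) ℝ := O.1
  let R : EuclideanSpace ℝ (Fin n) →ₗᵢ[ℝ] EuclideanSpace ℝ (Fin n) :=
    { toLinearMap := Matrix.toEuclideanLin M
      norm_map' := fun x => by
        have h1 : ∀ y : EuclideanSpace ℝ (Fin n), ‖y‖ ^ 2 = y.ofLp ⬝ᵥ y.ofLp := by
          intro y
          rw [EuclideanSpace.norm_sq_eq]
          simp [dotProduct, sq]
        rw [← sq_eq_sq₀ (norm_nonneg _) (norm_nonneg _), h1, h1]
        exact orthogonal_dotProduct O x.ofLp x.ofLp }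
  have hR := stdGaussian_map (R.toLinearIsometryEquiv rfl)
  rw [← map_pi_eq_stdGaussian, Measure.map_map (by fun_prop) (by fun_prop)] at hR
  have hm := congrArg (Measure.map (WithLp.ofLp (p := 2) (V := Fin n → ℝ))) hR
  rw [Measure.map_map (by fun_prop) (by fun_prop), Measure.map_map (by fun_prop) (by fun_prop)] at hm
  have e1 : (WithLp.ofLp (p := 2) (V := Fin n → ℝ)) ∘ (WithLp.toLp 2) = id := rfl
  rw [e1, Measure.map_id] at hm
  exact hm

lemma gaussPi_singleton_zero (hn : 0 < n) : gaussPi n {0} = 0 := by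
  have : ({0} : Set (Fin n → ℝ)) ⊆ (Function.eval ⟨0, hn⟩) ⁻¹' {0} := by
    rintro x rfl; rfl
  refine measure_mono_null this ?_
  rw [← Measure.map_apply (by fun_prop) (measurableSet_singleton _), gaussPi,
    (measurePreserving_eval (fun _ : Fin n => gaussianReal 0 1) ⟨0, hn⟩).map_eq]
  have := nullSingletonClass_gaussianReal (μ := 0) (v := 1) one_ne_zero
  exact measure_singleton _

lemma measurable_dotProduct_right (y : Fin n → ℝ) : Measurable fun θ : Fin n → ℝ => y ⬝ᵥ θ := by
  unfold dotProduct; fun_prop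

lemma measurable_dotProduct_uncurry :
    Measurable fun p : (Fin n → ℝ) × (Fin n → ℝ) => p.1 ⬝ᵥ p.2 := by
  unfold dotProduct; fun_prop

lemma measure_dotProduct_congr {μ : Measure (Fin n → ℝ)} {f : (Fin n → ℝ) → ℝ}
    (hf : Measurable f) (hfO : ∀ (O : Matrix.orthogonalGroup (Fin n) ℝ) x,
      f ((O : Matrix (Fin n) (Fin n) ℝ) *ᵥ x) = f x)
    (hμ : ∀ O : Matrix.orthogonalGroup (Fin n) ℝ,
      μ.map (fun x => (O : Matrix (Fin n) (Fin n) ℝ) *ᵥ x) = μ)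
    {A : Set ℝ} (hA : MeasurableSet A) {y y' : Fin n → ℝ} (h : y ⬝ᵥ y = y' ⬝ᵥ y') :
    μ {θ | f θ * (y ⬝ᵥ θ) ∈ A} = μ {θ | f θ * (y' ⬝ᵥ θ) ∈ A} := by
  obtain ⟨O, hO⟩ := exists_orthogonal_mulVec_eq h
  conv_rhs => rw [← hμ O]
  have hB : MeasurableSet {θ | f θ * (y' ⬝ᵥ θ) ∈ A} :=
    (hf.mul (measurable_dotProduct_right y')) hA
  rw [Measure.map_apply (measurable_mulVec _) hB]
  congr 1
  ext θ
  simp only [mem_ofPred_eq, mem_preimage, hfO, ← hO, orthogonal_dotProduct]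

/-- One-dimensional projections of the uniform measure on the sphere and of a normalized Gaussian
vector agree. -/
lemma IsUniformSphere.measure_dotProduct_mem (hn : 0 < n) {μ : Measure (Fin n → ℝ)}
    (hμ : IsUniformSphere μ) {A : Set ℝ} (hA : MeasurableSet A) (y : Fin n → ℝ) :
    μ {θ | y ⬝ᵥ θ ∈ A} = gaussPi n {z | (√(z ⬝ᵥ z))⁻¹ * (y ⬝ᵥ z) ∈ A} := by
  obtain ⟨hprob, hS, hrot⟩ := hμ
  have hnorm : Measurable fun z : Fin n → ℝ => (√(z ⬝ᵥ z))⁻¹ := by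
    unfold dotProduct; fun_prop
  have hSm : MeasurableSet (unitSphereSet n) := by
    unfold unitSphereSet
    exact measurableSet_eq_fun (by fun_prop) (by fun_prop)
  set r := √(y ⬝ᵥ y)
  have hr : r ^ 2 = y ⬝ᵥ y := Real.sq_sqrt (by
    rw [dotProduct]; exact Finset.sum_nonneg fun i _ => mul_self_nonneg _)
  set f : (Fin n → ℝ) × (Fin n → ℝ) → ℝ := fun p => (√(p.1 ⬝ᵥ p.1))⁻¹ * (r * (p.1 ⬝ᵥ p.2)) with hf
  have hfm : Measurable f := by
    refine Measurable.mul (hnorm.comp measurable_fst) (measurable_dotProduct_uncurry.const_mul r)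
  have hB : MeasurableSet (f ⁻¹' A) := hfm hA
  have e1 : (gaussPi n).prod μ (f ⁻¹' A) = μ {θ | y ⬝ᵥ θ ∈ A} := by
    rw [Measure.prod_apply hB]
    have : ∀ᵐ z ∂(gaussPi n), μ (Prod.mk z ⁻¹' (f ⁻¹' A)) = μ {θ | y ⬝ᵥ θ ∈ A} := by
      have h0 : ∀ᵐ z ∂(gaussPi n), z ≠ 0 := by
        rw [ae_iff]; simpa using gaussPi_singleton_zero hn
      filter_upwards [h0] with z hz
      have hz' : 0 < z ⬝ᵥ z := by
        refine lt_of_le_of_ne ?_ (Ne.symm (by rwa [Ne, dotProduct_self_eq_zero]))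
        rw [dotProduct]; exact Finset.sum_nonneg fun i _ => mul_self_nonneg _
      have := measure_dotProduct_congr (μ := μ) (f := fun _ => 1) (by fun_prop) (by simp) hrot hA
        (y := ((√(z ⬝ᵥ z))⁻¹ * r) • z) (y' := y) (by
          rw [smul_dotProduct, dotProduct_smul, smul_smul, smul_eq_mul, ← hr,
            show (√(z ⬝ᵥ z))⁻¹ * r * ((√(z ⬝ᵥ z))⁻¹ * r) = ((√(z ⬝ᵥ z)) ^ 2)⁻¹ * r ^ 2 by ring,
            Real.sq_sqrt hz'.le]
          field_simp)
      simp only [one_mul] at this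
      rw [← this]
      congr 1
      ext θ
      simp only [hf, mem_ofPred_eq, mem_preimage, smul_dotProduct, smul_eq_mul, mul_assoc]
    rw [lintegral_congr_ae this]
    simp
  have e2 : (gaussPi n).prod μ (f ⁻¹' A) =
      gaussPi n {z | (√(z ⬝ᵥ z))⁻¹ * (y ⬝ᵥ z) ∈ A} := by
    rw [Measure.prod_apply_symm hB]
    have : ∀ᵐ θ ∂μ, gaussPi n ((fun z => (z, θ)) ⁻¹' (f ⁻¹' A)) =
        gaussPi n {z | (√(z ⬝ᵥ z))⁻¹ * (y ⬝ᵥ z) ∈ A} := by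
      have h0 : ∀ᵐ θ ∂μ, θ ∈ unitSphereSet n := by
        have := (mem_ae_iff_prob_eq_one hSm).2 hS
        exact this
      filter_upwards [h0] with θ hθ
      have hθ' : θ ⬝ᵥ θ = 1 := by
        rw [← (show ∑ i, θ i ^ 2 = 1 from hθ)]
        simp [dotProduct, sq]
      rw [← measure_dotProduct_congr (μ := gaussPi n) hnorm
        (fun O x => by rw [orthogonal_dotProduct]) map_orthogonal_gaussPi hA
        (y := r • θ) (y' := y) (by
          rw [smul_dotProduct, dotProduct_smul, smul_smul, smul_eq_mul, hθ', ← hr]; ring)]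
      congr 1
      ext z
      simp only [hf, mem_ofPred_eq, mem_preimage, smul_dotProduct, smul_eq_mul,
        dotProduct_comm z θ]
    rw [lintegral_congr_ae this]
    simp
  rw [← e1, e2]

end Rotation

/-- The joint law of one coordinate of the product vector and one independent standard Gaussian. -/
def pairLaw (γ : Measure ℝ) : Measure (ℝ × ℝ) := γ.prod (gaussianReal 0 1)

instance (γ : Measure ℝ) [IsProbabilityMeasure γ] : IsProbabilityMeasure (pairLaw γ) := by
  unfold pairLaw; infer_instance

/-- The empirical average of the pairs `(z², z x)`. -/
def avgPair {n : ℕ} (ω : Fin n → ℝ × ℝ) : ℝ × ℝ :=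
  ((∑ i, (ω i).2 ^ 2) / n, (∑ i, (ω i).2 * (ω i).1) / n)

lemma measurable_avgPair {n : ℕ} : Measurable (avgPair (n := n)) := by
  unfold avgPair; fun_prop

lemma contr_avgPair {n : ℕ} (hn : 0 < n) (ω : Fin n → ℝ × ℝ) :
    contr (avgPair ω) = (n : ℝ) ^ (-(1:ℝ)/2) *
      ((√(∑ i, (ω i).2 ^ 2))⁻¹ * ∑ i, (ω i).1 * (ω i).2) := by
  have hn' : (0 : ℝ) < n := by exact_mod_cast hn
  have hS : 0 ≤ ∑ i, (ω i).2 ^ 2 := Finset.sum_nonneg fun i _ => sq_nonneg _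
  have hpow : ∀ a : ℝ, 0 ≤ a → a ^ (-(1:ℝ)/2) = (√a)⁻¹ := by
    intro a ha
    rw [show -(1:ℝ)/2 = -(1/2) by ring, Real.rpow_neg ha, Real.sqrt_eq_rpow]
  simp only [contr, avgPair]
  rw [hpow _ (by positivity), hpow _ hn'.le, Real.sqrt_div hS, inv_div]
  simp only [mul_comm (Prod.snd (ω _))]
  have h2 : √(n : ℝ) / n = (√(n : ℝ))⁻¹ := by
    apply eq_inv_of_mul_eq_one_left
    rw [div_mul_eq_mul_div, Real.mul_self_sqrt hn'.le]
    field_simp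
  rw [← h2]
  ring

lemma measure_dotp_mem {γ : Measure ℝ} [IsProbabilityMeasure γ]
    {Ω : Type*} [MeasurableSpace Ω] {P : Measure Ω} [IsProbabilityMeasure P]
    {n : ℕ} (hn : 0 < n) {X Θ : Ω → (Fin n → ℝ)} (hXm : Measurable X) (hΘm : Measurable Θ)
    (hX : Measure.map X P = Measure.pi (fun _ : Fin n => γ))
    (hΘ : IsUniformSphere (Measure.map Θ P)) (hind : IndepFun X Θ P)
    {A : Set ℝ} (hA : MeasurableSet A) :
    P {ω | (n : ℝ) ^ (-(1:ℝ)/2) * dotp (X ω) (Θ ω) ∈ A} =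
      Measure.pi (fun _ : Fin n => pairLaw γ) {ω | contr (avgPair ω) ∈ A} := by
  set c := (n : ℝ) ^ (-(1:ℝ)/2)
  have hcA : MeasurableSet {s : ℝ | c * s ∈ A} := (measurable_const_mul c) hA
  have : IsProbabilityMeasure (Measure.map Θ P) := hΘ.1
  have hW : MeasurableSet {p : (Fin n → ℝ) × (Fin n → ℝ) | c * dotp p.1 p.2 ∈ A} :=
    (measurable_dotProduct_uncurry.const_mul c) hA
  have hg : Measurable fun p : (Fin n → ℝ) × (Fin n → ℝ) =>
      c * ((√(dotp p.2 p.2))⁻¹ * dotp p.1 p.2) := by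
    unfold dotp; fun_prop
  have hV : MeasurableSet {p : (Fin n → ℝ) × (Fin n → ℝ) |
      c * ((√(dotp p.2 p.2))⁻¹ * dotp p.1 p.2) ∈ A} := hg hA
  calc P {ω | c * dotp (X ω) (Θ ω) ∈ A}
      = (Measure.map (fun ω => (X ω, Θ ω)) P) {p | c * dotp p.1 p.2 ∈ A} := by
        rw [Measure.map_apply (hXm.prodMk hΘm) hW]; rfl
    _ = ((Measure.pi fun _ : Fin n => γ).prod (Measure.map Θ P)) {p | c * dotp p.1 p.2 ∈ A} := by
        rw [(indepFun_iff_map_prod_eq_prod_map_map hXm.aemeasurable hΘm.aemeasurable).1 hind, hX]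
    _ = ((Measure.pi fun _ : Fin n => γ).prod (gaussPi n))
          {p | c * ((√(dotp p.2 p.2))⁻¹ * dotp p.1 p.2) ∈ A} := by
        rw [Measure.prod_apply hW, Measure.prod_apply hV]
        congr 1
        ext x
        exact hΘ.measure_dotProduct_mem hn hcA x
    _ = Measure.pi (fun _ : Fin n => pairLaw γ) {ω | contr (avgPair ω) ∈ A} := by
        rw [gaussPi, ← (measurePreserving_arrowProdEquivProdArrow ℝ ℝ (Fin n) (fun _ => γ)
          (fun _ => gaussianReal 0 1)).map_eq, Measure.map_apply (by fun_prop) hV]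
        congr 1
        ext ω
        simp only [mem_preimage, mem_ofPred_eq, contr_avgPair hn]
        simp only [dotp, ← sq]
        rfl

section ProductMeasures

variable {α : Type*} [MeasurableSpace α]

lemma lintegral_pi_prod {n : ℕ} (ρ : Measure α) [IsProbabilityMeasure ρ]
    {f : Fin n → α → ℝ≥0∞} (hf : ∀ i, Measurable (f i)) :
    ∫⁻ ω, ∏ i, f i (ω i) ∂(Measure.pi fun _ : Fin n => ρ) = ∏ i, ∫⁻ y, f i y ∂ρ := by
  have h : iIndepFun (fun (i : Fin n) (ω : Fin n → α) => f i (ω i))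
      (Measure.pi fun _ : Fin n => ρ) :=
    iIndepFun_pi fun i => (hf i).aemeasurable
  rw [lintegral_prod_eq_prod_lintegral_of_indepFun Finset.univ
    (fun (i : Fin n) (ω : Fin n → α) => f i (ω i)) h
    fun i => (hf i).comp (measurable_pi_apply i)]
  refine Finset.prod_congr rfl fun i _ => ?_
  exact (measurePreserving_eval (fun _ : Fin n => ρ) i).lintegral_comp (hf i)

lemma pi_withDensity {n : ℕ} (ρ : Measure α) [IsProbabilityMeasure ρ]
    {f : α → ℝ≥0∞} (hf : Measurable f) [IsProbabilityMeasure (ρ.withDensity f)] :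
    Measure.pi (fun _ : Fin n => ρ.withDensity f) =
      (Measure.pi fun _ : Fin n => ρ).withDensity fun ω => ∏ i, f (ω i) := by
  refine Measure.pi_eq fun s hs => ?_
  rw [withDensity_apply _ (MeasurableSet.univ_pi hs), ← lintegral_indicator (MeasurableSet.univ_pi hs)]
  have h : ∀ ω : Fin n → α, (univ.pi s).indicator (fun ω => ∏ i, f (ω i)) ω =
      ∏ i, (s i).indicator f (ω i) := by
    intro ω
    by_cases hω : ω ∈ univ.pi s
    · rw [indicator_of_mem hω]
      exact Finset.prod_congr rfl fun i _ => (indicator_of_mem (hω i (mem_univ i)) f).symm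
    · rw [indicator_of_notMem hω]
      simp only [Set.mem_pi, mem_univ, true_imp_iff, not_forall] at hω
      obtain ⟨i, hi⟩ := hω
      exact (Finset.prod_eq_zero (Finset.mem_univ i) (indicator_of_notMem hi f)).symm
  simp_rw [h]
  rw [lintegral_pi_prod ρ fun i => hf.indicator (hs i)]
  refine Finset.prod_congr rfl fun i _ => ?_
  rw [lintegral_indicator (hs i), withDensity_apply _ (hs i)]

end ProductMeasures

lemma lintegral_exp_pairLaw (κ : Measure ℝ) [SFinite κ] (t : ℝ × ℝ) :
    ∫⁻ y, ENNReal.ofReal (Real.exp (t.1 * y.2 ^ 2 + t.2 * (y.2 * y.1))) ∂(pairLaw κ) =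
      laplace κ t := by
  unfold pairLaw laplace
  rw [muP_two, lintegral_prod _ (by fun_prop)]
  simp only [mul_assoc]

lemma sum_exponent {n : ℕ} (hn : 0 < n) (t : ℝ × ℝ) (ω : Fin n → ℝ × ℝ) :
    ∑ i, (t.1 * (ω i).2 ^ 2 + t.2 * ((ω i).2 * (ω i).1)) =
      n * (t.1 * (avgPair ω).1 + t.2 * (avgPair ω).2) := by
  have hn' : (n : ℝ) ≠ 0 := by positivity
  rw [Finset.sum_add_distrib, ← Finset.mul_sum, ← Finset.mul_sum]
  simp only [avgPair]
  field_simp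

lemma prod_ofReal_exp {n : ℕ} (g : Fin n → ℝ) :
    ∏ i, ENNReal.ofReal (Real.exp (g i)) = ENNReal.ofReal (Real.exp (∑ i, g i)) := by
  rw [Real.exp_sum, ENNReal.ofReal_prod_of_nonneg fun i _ => (Real.exp_pos _).le]

lemma chernoff (γ : Measure ℝ) [IsProbabilityMeasure γ] {n : ℕ} (hn : 0 < n) (t : ℝ × ℝ) (α : ℝ) :
    Measure.pi (fun _ : Fin n => pairLaw γ)
      {ω | (α : EReal) < ((t.1 * (avgPair ω).1 + t.2 * (avgPair ω).2 : ℝ) : EReal) - Phig γ t}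
      ≤ ENNReal.ofReal (Real.exp (-(n * α))) := by
  by_cases hL : laplace γ t = ⊤
  · have : Phig γ t = ⊤ := by rw [Phig_eq_log_laplace, hL]; rfl
    simp [this]
  have hL0 : laplace γ t ≠ 0 := laplace_ne_zero (IsProbabilityMeasure.ne_zero γ) t
  set L := (laplace γ t).toReal with hLdef
  have hLpos : 0 < L := ENNReal.toReal_pos hL0 hL
  rw [Phig_eq_coe (lt_top_iff_ne_top.2 hL)]
  set μ := Measure.pi (fun _ : Fin n => pairLaw γ)
  set c := ENNReal.ofReal (Real.exp (n * α))
  have hsub : {ω : Fin n → ℝ × ℝ | (α : EReal) <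
      ((t.1 * (avgPair ω).1 + t.2 * (avgPair ω).2 : ℝ) : EReal) - (Real.log L : ℝ)} ⊆
      {ω | c * laplace γ t ^ n ≤
        ∏ i, ENNReal.ofReal (Real.exp (t.1 * (ω i).2 ^ 2 + t.2 * ((ω i).2 * (ω i).1)))} := by
    intro ω hω
    rw [mem_ofPred_eq, ← EReal.coe_sub, EReal.coe_lt_coe_iff] at hω
    rw [mem_ofPred_eq, prod_ofReal_exp, sum_exponent hn, ← ENNReal.ofReal_toReal hL,
      ← ENNReal.ofReal_pow hLpos.le, ← ENNReal.ofReal_mul (Real.exp_pos _).le]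
    refine ENNReal.ofReal_le_ofReal ?_
    nth_rewrite 1 [← Real.exp_log hLpos]
    rw [← Real.exp_nat_mul, ← Real.exp_add]
    refine Real.exp_le_exp.2 ?_
    rw [← mul_add]
    refine mul_le_mul_of_nonneg_left ?_ (by positivity)
    linarith
  have hmeas : Measurable fun ω : Fin n → ℝ × ℝ =>
      ∏ i, ENNReal.ofReal (Real.exp (t.1 * (ω i).2 ^ 2 + t.2 * ((ω i).2 * (ω i).1))) := by
    fun_prop
  have hmarkov := mul_meas_ge_le_lintegral (μ := μ) hmeas (c * laplace γ t ^ n)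
  have hint : ∫⁻ ω, ∏ i, ENNReal.ofReal
      (Real.exp (t.1 * (ω i).2 ^ 2 + t.2 * ((ω i).2 * (ω i).1))) ∂μ = laplace γ t ^ n := by
    rw [lintegral_pi_prod (pairLaw γ)
      (f := fun _ y => ENNReal.ofReal (Real.exp (t.1 * y.2 ^ 2 + t.2 * (y.2 * y.1))))
      (fun _ => by fun_prop)]
    simp [lintegral_exp_pairLaw]
  rw [hint] at hmarkov
  refine (measure_mono hsub).trans ?_
  set m := μ {ω | c * laplace γ t ^ n ≤
        ∏ i, ENNReal.ofReal (Real.exp (t.1 * (ω i).2 ^ 2 + t.2 * ((ω i).2 * (ω i).1)))}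
  have h1 : c * m ≤ 1 := by
    have h2 : laplace γ t ^ n * (c * m) ≤ laplace γ t ^ n * 1 := by
      calc _ = c * laplace γ t ^ n * m := by ring
        _ ≤ _ := by rwa [mul_one]
    exact (ENNReal.mul_le_mul_iff_right (pow_ne_zero _ hL0) (ENNReal.pow_ne_top hL)).1 h2
  rw [Real.exp_neg, ENNReal.ofReal_inv_of_pos (Real.exp_pos _)]
  rw [ENNReal.le_inv_iff_mul_le, mul_comm]
  exact h1

lemma exists_finset_lt (γ : Measure ℝ) [IsProbabilityMeasure γ] (hγ : memT 2 γ) {F : Set ℝ}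
    (hF : IsClosed F) {α : ℝ} (hα : ∀ w ∈ F, (α : EReal) < Iag γ w) :
    ∃ T : Finset (ℝ × ℝ), ∀ τ : ℝ × ℝ, contr τ ∈ F →
      ∃ t ∈ T, (α : EReal) < ((t.1 * τ.1 + t.2 * τ.2 : ℝ) : EReal) - Phig γ t := by
  classical
  obtain ⟨T, ε, hε, M, hT⟩ := exists_finset_lt_outside_box hγ α
  set K : Set (ℝ × ℝ) := (Icc ε M ×ˢ Icc (-M) M) ∩ contr ⁻¹' F
  have hbox : IsCompact (Icc ε M ×ˢ Icc (-M) M) := isCompact_Icc.prod isCompact_Icc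
  have hKc : IsClosed K := by
    refine (continuousOn_contr.mono ?_).preimage_isClosed_of_isClosed hbox.isClosed hF
    intro τ hτ
    exact lt_of_lt_of_le hε hτ.1.1
  have hK : IsCompact K := hbox.of_isClosed_subset hKc inter_subset_left
  let U : ℝ × ℝ → Set (ℝ × ℝ) := fun t =>
    {τ | (α : EReal) < ((t.1 * τ.1 + t.2 * τ.2 : ℝ) : EReal) - Phig γ t}
  have hU : ∀ t, IsOpen (U t) := by
    intro t
    by_cases hL : laplace γ t = ⊤
    · have : Phig γ t = ⊤ := by rw [Phig_eq_log_laplace, hL]; rfl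
      simp [U, this]
    · simp only [U, Phig_eq_coe (lt_top_iff_ne_top.2 hL), ← EReal.coe_sub, EReal.coe_lt_coe_iff]
      exact isOpen_lt continuous_const (by fun_prop)
  have hcov : K ⊆ ⋃ t, U t := by
    rintro τ ⟨hτ, hτF⟩
    have h1 := (hα _ hτF).trans_le (Iag_contr_le γ (lt_of_lt_of_le hε hτ.1.1))
    obtain ⟨t, ht⟩ := lt_iSup_iff.1 h1
    exact mem_iUnion.2 ⟨t, ht⟩
  obtain ⟨S, hS⟩ := hK.elim_finite_subcover U hU hcov
  refine ⟨T ∪ S, fun τ hτ => ?_⟩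
  by_cases hb : τ.1 < ε ∨ M < τ.1 ∨ M < |τ.2|
  · obtain ⟨t, ht, h⟩ := hT τ hb
    exact ⟨t, Finset.mem_union_left _ ht, h⟩
  · push Not at hb
    have hm : τ ∈ K := ⟨⟨⟨hb.1, hb.2.1⟩, abs_le.1 hb.2.2⟩, hτ⟩
    obtain ⟨t, ht, h⟩ := mem_iUnion₂.1 (hS hm)
    exact ⟨t, Finset.mem_union_right _ ht, h⟩

lemma exists_measure_contr_le (γ : Measure ℝ) [IsProbabilityMeasure γ] (hγ : memT 2 γ) {F : Set ℝ}
    (hF : IsClosed F) {α : ℝ} (hα : ∀ w ∈ F, (α : EReal) < Iag γ w) :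
    ∃ K : ℕ, ∀ n : ℕ, 0 < n →
      Measure.pi (fun _ : Fin n => pairLaw γ) {ω | contr (avgPair ω) ∈ F} ≤
        K * ENNReal.ofReal (Real.exp (-(n * α))) := by
  obtain ⟨T, hT⟩ := exists_finset_lt γ hγ hF hα
  refine ⟨T.card, fun n hn => ?_⟩
  calc _ ≤ Measure.pi (fun _ : Fin n => pairLaw γ) (⋃ t ∈ T, {ω | (α : EReal) <
        ((t.1 * (avgPair ω).1 + t.2 * (avgPair ω).2 : ℝ) : EReal) - Phig γ t}) := by
        refine measure_mono fun ω hω => ?_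
        obtain ⟨t, ht, h⟩ := hT _ hω
        exact mem_iUnion₂.2 ⟨t, ht, h⟩
    _ ≤ ∑ t ∈ T, Measure.pi (fun _ : Fin n => pairLaw γ) {ω | (α : EReal) <
        ((t.1 * (avgPair ω).1 + t.2 * (avgPair ω).2 : ℝ) : EReal) - Phig γ t} :=
        measure_biUnion_finset_le _ _
    _ ≤ ∑ t ∈ T, ENNReal.ofReal (Real.exp (-(n * α))) :=
        Finset.sum_le_sum fun t _ => chernoff γ hn t α
    _ = _ := by simp

/-- Exponential upper bounds on probabilities bound the normalized logarithmic limsup. -/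
lemma limsup_log_le {u : ℕ → ℝ≥0∞} {K : ℕ} {α : ℝ}
    (h : ∀ n, 0 < n → u n ≤ K * ENNReal.ofReal (Real.exp (-(n * α)))) :
    (atTop.limsup fun n : ℕ => (((n : ℝ)⁻¹ : ℝ) : EReal) * ENNReal.log (u n)) ≤
      ((-α : ℝ) : EReal) := by
  have hbd : ∀ n : ℕ, 0 < n → (((n : ℝ)⁻¹ : ℝ) : EReal) * ENNReal.log (u n) ≤
      (((n : ℝ)⁻¹ * Real.log (K + 1) - α : ℝ) : EReal) := by
    intro n hn
    have hn' : (0 : ℝ) < n := by exact_mod_cast hn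
    have h1 : u n ≤ ENNReal.ofReal ((K + 1) * Real.exp (-(n * α))) := by
      refine (h n hn).trans ?_
      rw [ENNReal.ofReal_mul (by positivity)]
      gcongr
      rw [← ENNReal.ofReal_natCast]
      exact ENNReal.ofReal_le_ofReal (by linarith)
    have h2 : ENNReal.log (u n) ≤ ((Real.log (K + 1) - n * α : ℝ) : EReal) := by
      refine (ENNReal.log_monotone h1).trans ?_
      rw [ENNReal.log_ofReal_of_pos (by positivity), Real.log_mul (by positivity) (by positivity),
        Real.log_exp, sub_eq_add_neg]
    calc _ ≤ (((n : ℝ)⁻¹ : ℝ) : EReal) * ((Real.log (K + 1) - n * α : ℝ) : EReal) :=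
          mul_le_mul_of_nonneg_left h2 (by exact_mod_cast (inv_pos.2 hn').le)
      _ = _ := by
          rw [← EReal.coe_mul]
          congr 1
          field_simp
  have hlim : Tendsto (fun n : ℕ => (((n : ℝ)⁻¹ * Real.log (K + 1) - α : ℝ) : EReal)) atTop
      (𝓝 ((-α : ℝ) : EReal)) := by
    refine (continuous_coe_real_ereal.tendsto _).comp ?_
    have := ((tendsto_inv_atTop_nhds_zero_nat (𝕜 := ℝ)).mul_const (Real.log (K + 1))).sub_const α
    simpa using this
  rw [← hlim.limsup_eq]
  exact limsup_le_limsup ((eventually_gt_atTop 0).mono hbd)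

section WeakLaw

variable {α : Type*} [MeasurableSpace α]

lemma integrable_exp_iff_lintegral_lt_top {Q : Measure α} {X : α → ℝ} (hX : Measurable X) (s : ℝ) :
    Integrable (fun y => Real.exp (s * X y)) Q ↔
      ∫⁻ y, ENNReal.ofReal (Real.exp (s * X y)) ∂Q < ⊤ := by
  have hm : AEStronglyMeasurable (fun y => Real.exp (s * X y)) Q := by
    have : Measurable fun y => Real.exp (s * X y) := by fun_prop
    exact this.aestronglyMeasurable
  rw [Integrable, and_iff_right hm,
    hasFiniteIntegral_iff_ofReal (ae_of_all _ fun _ => (Real.exp_pos _).le)]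

/-- If the moment generating function is finite near `0` and has a local minimum there, then the
variable is square integrable and centred. -/
lemma memLp_and_integral_eq_zero {Q : Measure α} [IsProbabilityMeasure Q] {X : α → ℝ}
    (hX : Measurable X)
    (hfin : ∀ᶠ s in 𝓝 (0 : ℝ), ∫⁻ y, ENNReal.ofReal (Real.exp (s * X y)) ∂Q < ⊤)
    (hmin : ∀ s : ℝ, 1 ≤ ∫⁻ y, ENNReal.ofReal (Real.exp (s * X y)) ∂Q) :
    MemLp X 2 Q ∧ ∫ y, X y ∂Q = 0 := by
  have h0 : (0 : ℝ) ∈ interior (integrableExpSet X Q) := by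
    rw [mem_interior_iff_mem_nhds]
    filter_upwards [hfin] with s hs
    exact (integrable_exp_iff_lintegral_lt_top hX s).2 hs
  refine ⟨by simpa using memLp_of_mem_interior_integrableExpSet h0 2, ?_⟩
  rw [← deriv_mgf_zero h0]
  refine IsLocalMin.deriv_eq_zero ?_
  filter_upwards [hfin] with s hs
  rw [mgf_zero, mgf, integral_eq_lintegral_of_nonneg_ae (ae_of_all _ fun _ => (Real.exp_pos _).le)
    ((integrable_exp_iff_lintegral_lt_top hX s).2 hs).aestronglyMeasurable]
  exact (ENNReal.toReal_mono hs.ne (hmin s)).trans_eq' (by simp)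

lemma eventually_pi_abs_avg_le {Q : Measure α} [IsProbabilityMeasure Q] {X : α → ℝ}
    (hX : MemLp X 2 Q) (h0 : ∫ y, X y ∂Q = 0) {δ ε : ℝ} (hδ : 0 < δ) (hε : 0 < ε) :
    ∀ᶠ n : ℕ in atTop, Measure.pi (fun _ : Fin n => Q) {ω | δ ≤ |(∑ i, X (ω i)) / n|} ≤
      ENNReal.ofReal ε := by
  have hlim : Tendsto (fun n : ℕ => Var[X; Q] / δ ^ 2 * (n : ℝ)⁻¹) atTop (𝓝 0) := by
    simpa using (tendsto_inv_atTop_nhds_zero_nat (𝕜 := ℝ)).const_mul (Var[X; Q] / δ ^ 2)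
  filter_upwards [hlim.eventually (gt_mem_nhds hε), eventually_gt_atTop 0] with n hn hn0
  have hn' : (0 : ℝ) < n := by exact_mod_cast hn0
  set μ := Measure.pi (fun _ : Fin n => Q)
  set S : (Fin n → α) → ℝ := ∑ i, fun ω => X (ω i)
  have hmem : ∀ i : Fin n, MemLp (fun ω : Fin n → α => X (ω i)) 2 μ := fun i =>
    hX.comp_measurePreserving (measurePreserving_eval (fun _ : Fin n => Q) i)
  have hS : MemLp S 2 μ := memLp_finsetSum' _ fun i _ => hmem i
  have hvar : Var[S; μ] = n * Var[X; Q] := by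
    have := variance_sum_pi (μ := fun _ : Fin n => Q) (X := fun _ => X) fun _ => hX
    simpa using this
  have hmean : ∫ ω, S ω ∂μ = 0 := by
    have : ∀ i : Fin n, ∫ ω, X (ω i) ∂μ = 0 := fun i => by
      rw [← h0]
      exact integral_comp_eval (μ := fun _ : Fin n => Q) hX.1
    simp only [S, Finset.sum_apply]
    rw [integral_finsetSum _ fun i _ => (hmem i).integrable one_le_two]
    simp [this]
  have hch := meas_ge_le_variance_div_sq hS (mul_pos hδ hn')
  rw [hmean, hvar] at hch
  simp only [sub_zero] at hch
  refine (measure_mono fun ω hω => ?_).trans (hch.trans (ENNReal.ofReal_le_ofReal ?_))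
  · rw [mem_ofPred_eq, abs_div, abs_of_pos hn', le_div_iff₀ hn'] at hω
    rw [mem_ofPred_eq]
    simpa [S, Finset.sum_apply] using hω
  · refine hn.le.trans' (le_of_eq ?_)
    field_simp

end WeakLaw

/-- The exponent of the exponential tilt of the pair law, centred at `τ`. -/
def tilt (τ t : ℝ × ℝ) (y : ℝ × ℝ) : ℝ := t.1 * (y.2 ^ 2 - τ.1) + t.2 * (y.2 * y.1 - τ.2)

@[fun_prop]
lemma measurable_tilt (τ t : ℝ × ℝ) : Measurable (tilt τ t) := by unfold tilt; fun_prop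

lemma tilt_add (τ t s y : ℝ × ℝ) : tilt τ (t + s) y = tilt τ t y + tilt τ s y := by
  simp only [tilt, Prod.fst_add, Prod.snd_add]; ring

/-- The Laplace transform of the pair law recentred at `τ`. -/
def tiltedLaplace (κ : Measure ℝ) (τ t : ℝ × ℝ) : ℝ≥0∞ :=
  ∫⁻ y, ENNReal.ofReal (Real.exp (tilt τ t y)) ∂(pairLaw κ)

lemma tiltedLaplace_eq (κ : Measure ℝ) [SFinite κ] (τ t : ℝ × ℝ) :
    tiltedLaplace κ τ t =
      ENNReal.ofReal (Real.exp (-(t.1 * τ.1 + t.2 * τ.2))) * laplace κ t := by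
  rw [← lintegral_exp_pairLaw, ← lintegral_const_mul _ (by fun_prop)]
  refine lintegral_congr fun y => ?_
  rw [← ENNReal.ofReal_mul (Real.exp_pos _).le, ← Real.exp_add]
  simp only [tilt]
  ring_nf

lemma laplace_lt_top_of_bounded {κ : Measure ℝ} [IsFiniteMeasure κ] {M : ℝ}
    (hM : ∀ᵐ x ∂κ, |x| ≤ M) {t : ℝ × ℝ} (ht : 0 < 1 - 2 * t.1) : laplace κ t < ⊤ := by
  rw [laplace_of_pos κ ht]
  refine ENNReal.mul_lt_top ENNReal.ofReal_lt_top ?_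
  calc _ ≤ ∫⁻ _, ENNReal.ofReal (Real.exp (t.2 ^ 2 * M ^ 2 / (2 * (1 - 2 * t.1)))) ∂κ := by
        refine lintegral_mono_ae ?_
        filter_upwards [hM] with x hx
        have : x ^ 2 ≤ M ^ 2 := sq_le_sq' (by linarith [neg_abs_le x]) ((le_abs_self x).trans hx)
        gcongr
    _ < ⊤ := by
        rw [lintegral_const]
        exact ENNReal.mul_lt_top ENNReal.ofReal_lt_top (measure_lt_top _ _)

/-- Lower bound at the mean of a tilted measure: if `t` minimizes the recentred Laplace transform of
a bounded part of `γ`, then the empirical pair is near `τ` with at least the corresponding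
exponential probability. -/
lemma eventually_le_measure_near (γ : Measure ℝ) [IsProbabilityMeasure γ] {S : Set ℝ}
    (hS : MeasurableSet S) {M : ℝ} (hSM : ∀ x ∈ S, |x| ≤ M) {τ t : ℝ × ℝ}
    (hS0 : γ.restrict S ≠ 0) (hfin : tiltedLaplace (γ.restrict S) τ t < ⊤)
    (hmin : ∀ s, tiltedLaplace (γ.restrict S) τ t ≤ tiltedLaplace (γ.restrict S) τ s)
    {δ : ℝ} (hδ : 0 < δ) :
    ∀ᶠ n : ℕ in atTop, 2⁻¹ * tiltedLaplace (γ.restrict S) τ t ^ n *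
        ENNReal.ofReal (Real.exp (-(n * (δ * (|t.1| + |t.2|))))) ≤
      Measure.pi (fun _ : Fin n => pairLaw γ)
        {ω | |(avgPair ω).1 - τ.1| < δ ∧ |(avgPair ω).2 - τ.2| < δ} := by
  set κ := γ.restrict S with hκ
  set Z := tiltedLaplace κ τ t with hZ
  have hbd : ∀ᵐ x ∂κ, |x| ≤ M := (ae_restrict_iff' hS).2 (ae_of_all _ hSM)
  have hZ0 : Z ≠ 0 := by
    rw [hZ, tiltedLaplace_eq]
    exact mul_ne_zero (by simp [Real.exp_pos]) (laplace_ne_zero hS0 t)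
  have ht : 0 < 1 - 2 * t.1 := by
    by_contra h
    rw [hZ, tiltedLaplace_eq, laplace_of_nonpos hS0 (not_lt.1 h),
      ENNReal.mul_top (by simp [Real.exp_pos])] at hfin
    exact lt_irrefl _ hfin
  set B : Set (ℝ × ℝ) := S ×ˢ univ
  have hB : MeasurableSet B := hS.prod MeasurableSet.univ
  have hpl : pairLaw κ = (pairLaw γ).restrict B := by
    unfold pairLaw
    rw [hκ, ← Measure.prod_restrict, Measure.restrict_univ]
  set f : ℝ × ℝ → ℝ≥0∞ := B.indicator fun y => Z⁻¹ * ENNReal.ofReal (Real.exp (tilt τ t y))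
    with hf
  have hfm : Measurable f := by
    refine Measurable.indicator ?_ hB
    fun_prop
  set Q := (pairLaw γ).withDensity f with hQ
  have hQint : ∀ g : ℝ × ℝ → ℝ≥0∞, Measurable g → ∫⁻ y, g y ∂Q =
      Z⁻¹ * ∫⁻ y, ENNReal.ofReal (Real.exp (tilt τ t y)) * g y ∂(pairLaw κ) := by
    intro g hg
    rw [hQ, lintegral_withDensity_eq_lintegral_mul _ hfm hg, hpl, ← lintegral_indicator hB,
      ← lintegral_const_mul _ (Measurable.indicator (by fun_prop) hB)]
    refine lintegral_congr fun y => ?_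
    by_cases hy : y ∈ B
    · simp only [hf, Pi.mul_apply, indicator_of_mem hy, mul_assoc]
    · simp only [hf, Pi.mul_apply, indicator_of_notMem hy, zero_mul, mul_zero]
  have hQexp : ∀ s, ∫⁻ y, ENNReal.ofReal (Real.exp (tilt τ s y)) ∂Q =
      Z⁻¹ * tiltedLaplace κ τ (t + s) := by
    intro s
    rw [hQint _ (by fun_prop)]
    congr 1
    refine lintegral_congr fun y => ?_
    rw [← ENNReal.ofReal_mul (Real.exp_pos _).le, ← Real.exp_add, tilt_add]
  have hQprob : IsProbabilityMeasure Q := by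
    refine ⟨?_⟩
    have := hQexp 0
    rw [add_zero, ← hZ, ENNReal.inv_mul_cancel hZ0 hfin.ne] at this
    simpa [tilt] using this
  have hdir : ∀ v : ℝ × ℝ, MemLp (tilt τ v) 2 Q ∧ ∫ y, tilt τ v y ∂Q = 0 := by
    intro v
    have hs : ∀ (s : ℝ) y, s * tilt τ v y = tilt τ (s • v) y := by
      intro s y
      simp only [tilt, Prod.smul_fst, Prod.smul_snd, smul_eq_mul]; ring
    refine memLp_and_integral_eq_zero (measurable_tilt τ v) ?_ ?_
    · have hc : ContinuousAt (fun s : ℝ => 1 - 2 * (t + s • v).1) 0 := by fun_prop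
      have ht' : 0 < 1 - 2 * (t + (0 : ℝ) • v).1 := by simpa only [zero_smul, add_zero] using ht
      filter_upwards [hc.eventually (lt_mem_nhds ht')] with s hs'
      simp only [hs, hQexp]
      rw [tiltedLaplace_eq]
      exact ENNReal.mul_lt_top (ENNReal.inv_lt_top.2 (pos_iff_ne_zero.2 hZ0))
        (ENNReal.mul_lt_top ENNReal.ofReal_lt_top (laplace_lt_top_of_bounded hbd hs'))
    · intro s
      simp only [hs, hQexp]
      rw [← ENNReal.inv_mul_cancel hZ0 hfin.ne]
      gcongr
      exact hmin _
  have h14 : (0 : ℝ) < 1 / 4 := by norm_num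
  filter_upwards [eventually_pi_abs_avg_le (hdir (1, 0)).1 (hdir (1, 0)).2 hδ h14,
    eventually_pi_abs_avg_le (hdir (0, 1)).1 (hdir (0, 1)).2 hδ h14,
    eventually_gt_atTop 0] with n h1 h2 hn
  have hn' : (0 : ℝ) < n := by exact_mod_cast hn
  have ha1 : ∀ ω : Fin n → ℝ × ℝ,
      (∑ i, tilt τ (1, 0) (ω i)) / n = (avgPair ω).1 - τ.1 := by
    intro ω
    simp [tilt, avgPair, sub_div, hn'.ne']
  have ha2 : ∀ ω : Fin n → ℝ × ℝ,
      (∑ i, tilt τ (0, 1) (ω i)) / n = (avgPair ω).2 - τ.2 := by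
    intro ω
    simp [tilt, avgPair, sub_div, hn'.ne']
  simp only [ha1] at h1
  simp only [ha2] at h2
  set E : Set (Fin n → ℝ × ℝ) := {ω | |(avgPair ω).1 - τ.1| < δ ∧ |(avgPair ω).2 - τ.2| < δ}
  have hE : MeasurableSet E := by
    have hm := measurable_avgPair (n := n)
    exact (measurableSet_lt (hm.fst.sub_const τ.1).norm measurable_const).inter
      (measurableSet_lt (hm.snd.sub_const τ.2).norm measurable_const)
  have hQE : 2⁻¹ ≤ Measure.pi (fun _ : Fin n => Q) E := by
    have hc : Measure.pi (fun _ : Fin n => Q) Eᶜ ≤ 2⁻¹ := by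
      calc _ ≤ Measure.pi (fun _ : Fin n => Q) ({ω | δ ≤ |(avgPair ω).1 - τ.1|} ∪
            {ω | δ ≤ |(avgPair ω).2 - τ.2|}) := by
            refine measure_mono fun ω hω => ?_
            by_contra hcon
            simp only [mem_union, mem_ofPred_eq, not_or, not_le] at hcon
            exact hω hcon
        _ ≤ _ := measure_union_le _ _
        _ ≤ ENNReal.ofReal (1 / 4) + ENNReal.ofReal (1 / 4) := add_le_add h1 h2
        _ = 2⁻¹ := by
            rw [← ENNReal.ofReal_add h14.le h14.le, ← ENNReal.ofReal_ofNat,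
              ← ENNReal.ofReal_inv_of_pos (by norm_num)]
            norm_num
    have h3 := prob_add_prob_compl (μ := Measure.pi (fun _ : Fin n => Q)) hE
    have h4 : (1 : ℝ≥0∞) ≤ Measure.pi (fun _ : Fin n => Q) E + 2⁻¹ := by
      rw [← h3]; gcongr
    rw [← ENNReal.inv_two_add_inv_two] at h4
    exact (ENNReal.add_le_add_iff_right (by simp)).1 h4
  set c := ENNReal.ofReal (Real.exp (n * (δ * (|t.1| + |t.2|)))) with hc
  have hup : Measure.pi (fun _ : Fin n => Q) E ≤
      (Z⁻¹ ^ n * c) * Measure.pi (fun _ : Fin n => pairLaw γ) E := by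
    rw [hQ, pi_withDensity (pairLaw γ) hfm, withDensity_apply _ hE, ← setLIntegral_const]
    refine setLIntegral_mono measurable_const fun ω hω => ?_
    calc ∏ i, f (ω i) ≤ ∏ i, (Z⁻¹ * ENNReal.ofReal (Real.exp (tilt τ t (ω i)))) :=
          Finset.prod_le_prod' fun i _ => indicator_le_self _ _ _
      _ = Z⁻¹ ^ n * ENNReal.ofReal (Real.exp (∑ i, tilt τ t (ω i))) := by
          rw [Finset.prod_mul_distrib, prod_ofReal_exp]; simp
      _ ≤ Z⁻¹ ^ n * c := by
          gcongr
          have hsum : ∑ i, tilt τ t (ω i) =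
              n * (t.1 * ((avgPair ω).1 - τ.1) + t.2 * ((avgPair ω).2 - τ.2)) := by
            rw [← ha1, ← ha2]
            simp only [tilt]
            rw [Finset.sum_add_distrib, ← Finset.mul_sum, ← Finset.mul_sum]
            field_simp
            simp
          rw [hsum, hc]
          gcongr
          have e1 : t.1 * ((avgPair ω).1 - τ.1) ≤ |t.1| * δ :=
            (le_abs_self _).trans (by rw [abs_mul]; gcongr; exact hω.1.le)
          have e2 : t.2 * ((avgPair ω).2 - τ.2) ≤ |t.2| * δ :=
            (le_abs_self _).trans (by rw [abs_mul]; gcongr; exact hω.2.le)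
          linarith
  have hcinv : ENNReal.ofReal (Real.exp (-(n * (δ * (|t.1| + |t.2|))))) = c⁻¹ := by
    rw [hc, Real.exp_neg, ENNReal.ofReal_inv_of_pos (Real.exp_pos _)]
  have hc0 : c ≠ 0 := by simp [hc, Real.exp_pos]
  have hct : c ≠ ⊤ := ENNReal.ofReal_ne_top
  rw [hcinv]
  calc 2⁻¹ * Z ^ n * c⁻¹ ≤ (Z⁻¹ ^ n * c * Measure.pi (fun _ : Fin n => pairLaw γ) E) *
        Z ^ n * c⁻¹ := by
        gcongr
        exact hQE.trans hup
    _ = (Z⁻¹ * Z) ^ n * (c * c⁻¹) * Measure.pi (fun _ : Fin n => pairLaw γ) E := by ring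
    _ = _ := by
        rw [ENNReal.inv_mul_cancel hZ0 hfin.ne, ENNReal.mul_inv_cancel hc0 hct, one_pow, one_mul,
          one_mul]

lemma isClosed_tiltedLaplace_le (κ : Measure ℝ) (τ : ℝ × ℝ) (c : ℝ≥0∞) :
    IsClosed {t | tiltedLaplace κ τ t ≤ c} := by
  refine IsSeqClosed.isClosed fun u t hu hut => ?_
  have hlim : ∀ y, ENNReal.ofReal (Real.exp (tilt τ t y)) =
      atTop.liminf fun k => ENNReal.ofReal (Real.exp (tilt τ (u k) y)) := by
    intro y
    refine (Tendsto.liminf_eq ?_).symm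
    have hc : Continuous fun s => ENNReal.ofReal (Real.exp (tilt τ s y)) := by
      refine ENNReal.continuous_ofReal.comp ?_
      unfold tilt; fun_prop
    exact (hc.tendsto t).comp hut
  rw [mem_ofPred_eq, tiltedLaplace]
  simp_rw [hlim]
  refine (lintegral_liminf_le fun k => by fun_prop).trans ?_
  refine liminf_le_of_le (by isBoundedDefault) fun b hb => ?_
  obtain ⟨k, hk⟩ := hb.exists
  exact hk.trans (hu k)

lemma le_tiltedLaplace (κ : Measure ℝ) [SFinite κ] (τ : ℝ × ℝ) {t : ℝ × ℝ} (ht : 0 < 1 - 2 * t.1)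
    {b : ℝ} (hb : 0 ≤ b) :
    ENNReal.ofReal ((√(1 - 2 * t.1))⁻¹ *
        Real.exp (t.2 ^ 2 * b ^ 2 / (2 * (1 - 2 * t.1)) - (t.1 * τ.1 + t.2 * τ.2))) *
      κ {x | b ≤ |x|} ≤ tiltedLaplace κ τ t := by
  rw [tiltedLaplace_eq, laplace_of_pos κ ht]
  have hm := mul_meas_ge_le_lintegral (μ := κ)
    (f := fun x => ENNReal.ofReal (Real.exp (t.2 ^ 2 * x ^ 2 / (2 * (1 - 2 * t.1)))))
    (by fun_prop) (ENNReal.ofReal (Real.exp (t.2 ^ 2 * b ^ 2 / (2 * (1 - 2 * t.1)))))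
  have hsub : {x | b ≤ |x|} ⊆ {x | ENNReal.ofReal (Real.exp (t.2 ^ 2 * b ^ 2 / (2 * (1 - 2 * t.1))))
      ≤ ENNReal.ofReal (Real.exp (t.2 ^ 2 * x ^ 2 / (2 * (1 - 2 * t.1))))} := by
    intro x hx
    rw [mem_ofPred_eq] at hx ⊢
    have h2 : b ^ 2 ≤ x ^ 2 := by rw [← sq_abs x]; gcongr
    gcongr
  rw [sub_eq_add_neg (t.2 ^ 2 * b ^ 2 / _), Real.exp_add, ENNReal.ofReal_mul (by positivity),
    ENNReal.ofReal_mul (by positivity)]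
  calc _ = ENNReal.ofReal (Real.exp (-(t.1 * τ.1 + t.2 * τ.2))) * (ENNReal.ofReal
        (√(1 - 2 * t.1))⁻¹ * (ENNReal.ofReal (Real.exp (t.2 ^ 2 * b ^ 2 / (2 * (1 - 2 * t.1)))) *
          κ {x | b ≤ |x|})) := by ring
    _ ≤ _ := by
      gcongr
      exact le_trans (by gcongr) hm

/-- The elementary coercivity estimate behind boundedness of sublevel sets. -/
lemma exists_bound_of_exp_le {b p C : ℝ} {τ : ℝ × ℝ} (hτ : 0 < τ.1) (hb : τ.2 ^ 2 < b ^ 2 * τ.1)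
    (hp : 0 < p) :
    ∃ R : ℝ, ∀ t : ℝ × ℝ, 0 < 1 - 2 * t.1 →
      (√(1 - 2 * t.1))⁻¹ *
        Real.exp (t.2 ^ 2 * b ^ 2 / (2 * (1 - 2 * t.1)) - (t.1 * τ.1 + t.2 * τ.2)) * p ≤ C →
      1 - 2 * t.1 ≤ R ∧ t.2 ^ 2 ≤ R := by
  have hb2 : 0 < b ^ 2 := by
    by_contra h
    have : b ^ 2 = 0 := le_antisymm (not_lt.1 h) (sq_nonneg b)
    rw [this, zero_mul] at hb
    exact absurd hb (not_lt.2 (sq_nonneg _))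
  have hlt : τ.2 ^ 2 / (b ^ 2 * τ.1) < 1 := (div_lt_one (by positivity)).2 hb
  obtain ⟨k, hk1, hk2⟩ := exists_between hlt
  have hk0 : 0 < k := lt_of_le_of_lt (by positivity) hk1
  set c₁ := (1 - k) * b ^ 2 / 2 with hc₁
  set c₂ := (τ.1 - τ.2 ^ 2 / (k * b ^ 2)) / 2 with hc₂
  have hc₁pos : 0 < c₁ := by
    have : 0 < 1 - k := by linarith
    positivity
  have hc₂pos : 0 < c₂ := by
    rw [div_lt_iff₀ (by positivity)] at hk1
    have : τ.2 ^ 2 / (k * b ^ 2) < τ.1 := by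
      rw [div_lt_iff₀ (by positivity)]; linarith
    rw [hc₂]; linarith
  set C' := max (C / p * Real.exp (τ.1 / 2)) 0 with hC'
  have hC'0 : 0 ≤ C' := le_max_right _ _
  refine ⟨max ((C' / c₂) ^ 2) (C' * (C' / c₂) ^ 3 / c₁), fun t ht h => ?_⟩
  set r := √(1 - 2 * t.1) with hr
  have hrpos : 0 < r := Real.sqrt_pos.2 ht
  have hrsq : 1 - 2 * t.1 = r ^ 2 := (Real.sq_sqrt ht.le).symm
  have ht1 : t.1 = (1 - r ^ 2) / 2 := by linarith
  rw [hrsq] at h ⊢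
  have hQ : c₁ * (t.2 ^ 2 / r ^ 2) + c₂ * r ^ 2 - τ.1 / 2 ≤
      t.2 ^ 2 * b ^ 2 / (2 * r ^ 2) - (t.1 * τ.1 + t.2 * τ.2) := by
    have hsq : 0 ≤ (k * b ^ 2 * (t.2 / r) - τ.2 * r) ^ 2 / (2 * (k * b ^ 2)) := by positivity
    have heq : t.2 ^ 2 * b ^ 2 / (2 * r ^ 2) - (t.1 * τ.1 + t.2 * τ.2) -
        (c₁ * (t.2 ^ 2 / r ^ 2) + c₂ * r ^ 2 - τ.1 / 2) =
        (k * b ^ 2 * (t.2 / r) - τ.2 * r) ^ 2 / (2 * (k * b ^ 2)) := by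
      rw [hc₁, hc₂, ht1]
      have : b ≠ 0 := by rintro rfl; simp at hb2
      field_simp
      ring
    linarith
  have hexp : Real.exp (c₁ * (t.2 ^ 2 / r ^ 2) + c₂ * r ^ 2) ≤ C' * r := by
    have h1 : r⁻¹ * Real.exp (c₁ * (t.2 ^ 2 / r ^ 2) + c₂ * r ^ 2 - τ.1 / 2) * p ≤ C :=
      le_trans (by gcongr) h
    rw [Real.exp_sub] at h1
    have h2 : Real.exp (c₁ * (t.2 ^ 2 / r ^ 2) + c₂ * r ^ 2) ≤ C / p * Real.exp (τ.1 / 2) * r := by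
      have he := Real.exp_pos (τ.1 / 2)
      rw [← le_div_iff₀ hp] at h1
      have h3 := mul_le_mul_of_nonneg_right h1 (mul_pos he hrpos).le
      calc _ = _ := ?_
        _ ≤ _ := h3
        _ = _ := by ring
      field_simp
    exact h2.trans (by gcongr; exact le_max_left _ _)
  have hlin : c₁ * (t.2 ^ 2 / r ^ 2) + c₂ * r ^ 2 ≤ C' * r := by
    linarith [Real.add_one_le_exp (c₁ * (t.2 ^ 2 / r ^ 2) + c₂ * r ^ 2)]
  have hrR : r ≤ C' / c₂ := by
    rw [le_div_iff₀ hc₂pos]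
    have : 0 ≤ c₁ * (t.2 ^ 2 / r ^ 2) := by positivity
    nlinarith
  refine ⟨le_max_of_le_left (by gcongr), le_max_of_le_right ?_⟩
  have h5 : c₁ * (t.2 ^ 2 / r ^ 2) ≤ C' * r := by
    have : 0 ≤ c₂ * r ^ 2 := by positivity
    linarith
  have h6 : c₁ * t.2 ^ 2 ≤ C' * r ^ 3 := by
    calc c₁ * t.2 ^ 2 = c₁ * (t.2 ^ 2 / r ^ 2) * r ^ 2 := by field_simp
      _ ≤ C' * r * r ^ 2 := by gcongr
      _ = _ := by ring
  rw [le_div_iff₀ hc₁pos]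
  calc t.2 ^ 2 * c₁ = c₁ * t.2 ^ 2 := by ring
    _ ≤ _ := h6
    _ ≤ _ := by gcongr

lemma isCompact_tiltedLaplace_le (κ : Measure ℝ) [IsFiniteMeasure κ] {τ : ℝ × ℝ} (hτ : 0 < τ.1)
    {b : ℝ} (hb0 : 0 ≤ b) (hb : τ.2 ^ 2 < b ^ 2 * τ.1) (hκ : κ {x | b ≤ |x|} ≠ 0)
    {c : ℝ≥0∞} (hc : c ≠ ⊤) : IsCompact {t | tiltedLaplace κ τ t ≤ c} := by
  have hκ0 : κ ≠ 0 := by rintro rfl; simp at hκ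
  have hp : 0 < (κ {x | b ≤ |x|}).toReal := ENNReal.toReal_pos hκ (measure_ne_top _ _)
  obtain ⟨R, hR⟩ := exists_bound_of_exp_le (C := c.toReal) hτ hb hp
  refine (isCompact_Icc.prod isCompact_Icc : IsCompact
    (Icc ((1 - R) / 2) (1 / 2) ×ˢ Icc (-√R) √R)).of_isClosed_subset
    (isClosed_tiltedLaplace_le κ τ c) fun t ht => ?_
  rw [mem_ofPred_eq] at ht
  have hpos : 0 < 1 - 2 * t.1 := by
    by_contra h
    rw [tiltedLaplace_eq, laplace_of_nonpos hκ0 (not_lt.1 h),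
      ENNReal.mul_top (by simp [Real.exp_pos])] at ht
    exact hc (top_le_iff.1 ht)
  have h1 := (le_tiltedLaplace κ τ hpos hb0).trans ht
  obtain ⟨h2, h3⟩ := hR t hpos (by
    rw [← ENNReal.toReal_ofReal (mul_nonneg (mul_nonneg (inv_nonneg.2 (Real.sqrt_nonneg _))
      (Real.exp_pos _).le) hp.le), ENNReal.ofReal_mul (by positivity),
      ENNReal.ofReal_toReal (measure_ne_top _ _)]
    exact ENNReal.toReal_mono hc h1)
  have h4 := Real.abs_le_sqrt h3
  exact ⟨⟨by linarith, by linarith⟩, abs_le.1 h4⟩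

lemma exists_forall_tiltedLaplace_le (κ : Measure ℝ) [IsFiniteMeasure κ] {τ : ℝ × ℝ}
    (hτ : 0 < τ.1) {b : ℝ} (hb0 : 0 ≤ b) (hb : τ.2 ^ 2 < b ^ 2 * τ.1)
    (hκ : κ {x | b ≤ |x|} ≠ 0) :
    ∃ t, tiltedLaplace κ τ t < ⊤ ∧ ∀ s, tiltedLaplace κ τ t ≤ tiltedLaplace κ τ s := by
  have h0 : tiltedLaplace κ τ 0 ≠ ⊤ := by
    rw [tiltedLaplace_eq, laplace_zero]
    exact ENNReal.mul_ne_top ENNReal.ofReal_ne_top (measure_ne_top _ _)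
  have hK := isCompact_tiltedLaplace_le κ hτ hb0 hb hκ h0
  have hl : LowerSemicontinuous (tiltedLaplace κ τ) :=
    lowerSemicontinuous_iff_isClosed_preimage.2 fun c => isClosed_tiltedLaplace_le κ τ c
  obtain ⟨t, ht, hmin⟩ := (hl.lowerSemicontinuousOn _).exists_isMinOn
    (s := {t | tiltedLaplace κ τ t ≤ tiltedLaplace κ τ 0}) ⟨0, le_refl (tiltedLaplace κ τ 0)⟩ hK
  refine ⟨t, lt_of_le_of_lt ht (lt_top_iff_ne_top.2 h0), fun s => ?_⟩
  by_cases hs : tiltedLaplace κ τ s ≤ tiltedLaplace κ τ 0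
  · exact hmin hs
  · exact le_trans ht (not_le.1 hs).le

lemma tiltedLaplace_mono {κ κ' : Measure ℝ} [SFinite κ] [SFinite κ'] (h : κ ≤ κ') (τ t : ℝ × ℝ) :
    tiltedLaplace κ τ t ≤ tiltedLaplace κ' τ t := by
  rw [tiltedLaplace_eq, tiltedLaplace_eq]
  gcongr
  exact laplace_mono h t

lemma lt_tiltedLaplace_of_legendre2_lt (γ : Measure ℝ) [IsProbabilityMeasure γ] {τ : ℝ × ℝ} {α : ℝ}
    (h : legendre2 (Phig γ) τ < α) (t : ℝ × ℝ) :
    ENNReal.ofReal (Real.exp (-α)) < tiltedLaplace γ τ t := by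
  rw [tiltedLaplace_eq]
  have hle := (le_legendre2 (Phig γ) t τ).trans_lt h
  by_cases hL : laplace γ t = ⊤
  · rw [hL, ENNReal.mul_top (by simp [Real.exp_pos])]
    exact ENNReal.ofReal_lt_top
  · have hLpos : 0 < (laplace γ t).toReal :=
      ENNReal.toReal_pos (laplace_ne_zero (IsProbabilityMeasure.ne_zero γ) t) hL
    rw [Phig_eq_coe (lt_top_iff_ne_top.2 hL), ← EReal.coe_sub, EReal.coe_lt_coe_iff] at hle
    rw [← ENNReal.ofReal_toReal hL, ← ENNReal.ofReal_mul (Real.exp_pos _).le,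
      ENNReal.ofReal_lt_ofReal_iff (by positivity)]
    nth_rewrite 1 [← Real.exp_log hLpos]
    rw [← Real.exp_add]
    exact Real.exp_lt_exp.2 (by linarith)

lemma monotone_restrict_Icc (γ : Measure ℝ) :
    Monotone fun M : ℕ => γ.restrict (Icc (-(M : ℝ)) M) := by
  intro M N h
  have : (M : ℝ) ≤ N := by exact_mod_cast h
  exact Measure.restrict_mono (Icc_subset_Icc (by linarith) this) le_rfl

lemma iUnion_Icc_natCast : ⋃ M : ℕ, Icc (-(M : ℝ)) M = univ := by
  refine eq_univ_of_forall fun x => ?_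
  obtain ⟨M, hM⟩ := exists_nat_ge |x|
  exact mem_iUnion.2 ⟨M, abs_le.1 hM⟩

lemma monotone_Icc_natCast : Monotone fun M : ℕ => Icc (-(M : ℝ)) M := by
  intro M N h
  have : (M : ℝ) ≤ N := by exact_mod_cast h
  exact Icc_subset_Icc (by linarith) this

lemma laplace_le_of_forall_restrict (γ : Measure ℝ) [IsProbabilityMeasure γ] (t : ℝ × ℝ)
    {τ : ℝ × ℝ} {c : ℝ≥0∞} (M₀ : ℕ)
    (h : ∀ M : ℕ, M₀ ≤ M → tiltedLaplace (γ.restrict (Icc (-(M : ℝ)) M)) τ t ≤ c) :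
    tiltedLaplace γ τ t ≤ c := by
  have hall : ∀ M : ℕ, tiltedLaplace (γ.restrict (Icc (-(M : ℝ)) M)) τ t ≤ c := fun M =>
    (tiltedLaplace_mono (monotone_restrict_Icc γ (le_max_left M M₀)) τ t).trans
      (h _ (le_max_right _ _))
  set e := ENNReal.ofReal (Real.exp (-(t.1 * τ.1 + t.2 * τ.2)))
  set g : ℝ → ℝ≥0∞ := fun x =>
    ∫⁻ z, ENNReal.ofReal (Real.exp (t.1 * z ^ 2 + t.2 * z * x)) ∂(muP 2)
  have hU : ∫⁻ x, g x ∂γ = ⨆ M : ℕ, ∫⁻ x in Icc (-(M : ℝ)) M, g x ∂γ := by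
    rw [← setLIntegral_iUnion_of_directed g monotone_Icc_natCast.directed_le, iUnion_Icc_natCast,
      Measure.restrict_univ]
  rw [tiltedLaplace_eq, laplace]
  change e * ∫⁻ x, g x ∂γ ≤ c
  rw [hU, ENNReal.mul_iSup]
  refine iSup_le fun M => ?_
  have := hall M
  rwa [tiltedLaplace_eq] at this

lemma exists_truncation (γ : Measure ℝ) [IsProbabilityMeasure γ] {τ : ℝ × ℝ} (hτ : 0 < τ.1)
    {b : ℝ} (hb0 : 0 ≤ b) (hb : τ.2 ^ 2 < b ^ 2 * τ.1) (hγb : γ {x | b ≤ |x|} ≠ 0) {α : ℝ}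
    (hα : legendre2 (Phig γ) τ < α) :
    ∃ M : ℕ, γ.restrict (Icc (-(M : ℝ)) M) {x | b ≤ |x|} ≠ 0 ∧
      ∀ t, ENNReal.ofReal (Real.exp (-α)) <
        tiltedLaplace (γ.restrict (Icc (-(M : ℝ)) M)) τ t := by
  have hmb : MeasurableSet {x : ℝ | b ≤ |x|} := measurableSet_le measurable_const (by fun_prop)
  obtain ⟨M₀, hM₀⟩ : ∃ M : ℕ, γ.restrict (Icc (-(M : ℝ)) M) {x | b ≤ |x|} ≠ 0 := by
    by_contra hcon
    push Not at hcon
    refine hγb (measure_mono_null (t := ⋃ M : ℕ, {x | b ≤ |x|} ∩ Icc (-(M : ℝ)) M) ?_ ?_)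
    · rw [← inter_iUnion, iUnion_Icc_natCast, inter_univ]
    · refine measure_iUnion_null fun M => ?_
      rw [← Measure.restrict_apply hmb, hcon M]
  have hM : ∀ M : ℕ, γ.restrict (Icc (-((M + M₀ : ℕ) : ℝ)) (M + M₀ : ℕ)) {x | b ≤ |x|} ≠ 0 := by
    intro M h0
    have := monotone_restrict_Icc γ (Nat.le_add_left M₀ M) {x | b ≤ |x|}
    rw [h0] at this
    exact hM₀ (le_antisymm this zero_le)
  by_contra hcon
  push Not at hcon
  let K : ℕ → Set (ℝ × ℝ) := fun M => {t |
    tiltedLaplace (γ.restrict (Icc (-((M + M₀ : ℕ) : ℝ)) (M + M₀ : ℕ))) τ t ≤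
      ENNReal.ofReal (Real.exp (-α))}
  have hKanti : Antitone K := by
    intro M N hMN t ht
    exact (tiltedLaplace_mono (monotone_restrict_Icc γ (Nat.add_le_add_right hMN M₀)) τ t).trans ht
  have hKne : ∀ M, (K M).Nonempty := fun M => hcon (M + M₀) (hM M)
  have hKc : ∀ M, IsCompact (K M) := fun M =>
    isCompact_tiltedLaplace_le _ hτ hb0 hb (hM M) ENNReal.ofReal_ne_top
  obtain ⟨t, ht⟩ := IsCompact.nonempty_iInter_of_directed_nonempty_isCompact_isClosed K
    hKanti.directed_ge hKne hKc fun M => isClosed_tiltedLaplace_le _ _ _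
  rw [mem_iInter] at ht
  refine absurd (lt_tiltedLaplace_of_legendre2_lt γ hα t) (not_lt.2 ?_)
  refine laplace_le_of_forall_restrict γ t M₀ fun M hle => ?_
  have := ht (M - M₀)
  simp only [K, mem_ofPred_eq, Nat.sub_add_cancel hle] at this
  exact this

/-- If `γ` is concentrated where `x² τ₁ ≤ τ₂²` and `τ₂ ≠ 0`, the Legendre transform is infinite. -/
lemma legendre2_eq_top_of_ae_le (γ : Measure ℝ) [IsProbabilityMeasure γ] {τ : ℝ × ℝ}
    (hτ : 0 < τ.1) (hτ2 : τ.2 ≠ 0) (h : ∀ᵐ x ∂γ, x ^ 2 * τ.1 ≤ τ.2 ^ 2) :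
    legendre2 (Phig γ) τ = ⊤ := by
  rw [EReal.eq_top_iff_forall_lt]
  intro c
  set a := Real.exp (2 * c) with ha
  have hapos : 0 < a := Real.exp_pos _
  set t : ℝ × ℝ := ((1 - a) / 2, a * τ.1 / τ.2)
  have hta : 1 - 2 * t.1 = a := by simp only [t]; ring
  have hL : laplace γ t ≤ ENNReal.ofReal (Real.exp (-c + a * τ.1 / 2)) := by
    rw [laplace_of_pos γ (by rw [hta]; exact hapos), hta]
    have hs : √a = Real.exp c := by
      rw [ha, mul_comm, Real.exp_mul, Real.sqrt_eq_rpow, ← Real.rpow_mul (Real.exp_pos _).le]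
      norm_num
    calc _ ≤ ENNReal.ofReal (√a)⁻¹ * ∫⁻ _, ENNReal.ofReal (Real.exp (a * τ.1 / 2)) ∂γ := by
          refine mul_le_mul_right ?_ _
          refine lintegral_mono_ae ?_
          filter_upwards [h] with x hx
          refine ENNReal.ofReal_le_ofReal (Real.exp_le_exp.2 ?_)
          have hτ2' : 0 < τ.2 ^ 2 := by positivity
          calc t.2 ^ 2 * x ^ 2 / (2 * a) = a * τ.1 / (2 * τ.2 ^ 2) * (x ^ 2 * τ.1) := by
                simp only [t]; field_simp
            _ ≤ a * τ.1 / (2 * τ.2 ^ 2) * τ.2 ^ 2 := by gcongr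
            _ = _ := by field_simp
      _ = _ := by
          rw [lintegral_const, measure_univ, mul_one, hs, ← Real.exp_neg,
            ← ENNReal.ofReal_mul (Real.exp_pos _).le, ← Real.exp_add]
  have hPhi : Phig γ t ≤ ((-c + a * τ.1 / 2 : ℝ) : EReal) := by
    rw [Phig_eq_log_laplace]
    refine (ENNReal.log_monotone hL).trans ?_
    rw [ENNReal.log_ofReal_of_pos (Real.exp_pos _), Real.log_exp]
  refine lt_of_lt_of_le ?_ (le_legendre2 (Phig γ) t τ)
  refine lt_of_lt_of_le ?_ (EReal.sub_le_sub le_rfl hPhi)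
  rw [← EReal.coe_sub, EReal.coe_lt_coe_iff]
  have : t.1 * τ.1 + t.2 * τ.2 = τ.1 / 2 + a * τ.1 / 2 := by
    simp only [t]; field_simp; ring
  linarith

lemma ae_sq_mul_le (γ : Measure ℝ) {τ : ℝ × ℝ} (hτ : 0 < τ.1)
    (h : ∀ b : ℝ, 0 ≤ b → τ.2 ^ 2 < b ^ 2 * τ.1 → γ {x | b ≤ |x|} = 0) :
    ∀ᵐ x ∂γ, x ^ 2 * τ.1 ≤ τ.2 ^ 2 := by
  set m := √(τ.2 ^ 2 / τ.1) with hm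
  have hmsq : m ^ 2 * τ.1 = τ.2 ^ 2 := by
    rw [hm, Real.sq_sqrt (by positivity)]; field_simp
  have hm0 : 0 ≤ m := Real.sqrt_nonneg _
  have hall : ∀ᵐ x ∂γ, ∀ k : ℕ, |x| < m + 1 / ((k : ℝ) + 1) := by
    rw [ae_all_iff]
    intro k
    have hk : 0 < 1 / ((k : ℝ) + 1) := by positivity
    have := h (m + 1 / ((k : ℝ) + 1)) (by positivity) (by
      rw [← hmsq]; gcongr; linarith)
    rw [ae_iff]
    simpa only [not_lt] using this
  filter_upwards [hall] with x hx
  have hxm : |x| ≤ m := by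
    have ht : Tendsto (fun k : ℕ => m + 1 / ((k : ℝ) + 1)) atTop (𝓝 (m + 0)) :=
      tendsto_one_div_add_atTop_nhds_zero_nat.const_add m
    rw [add_zero] at ht
    exact ge_of_tendsto' ht fun k => (hx k).le
  rw [← hmsq, ← sq_abs x]
  gcongr

lemma exists_box_subset_contr {G : Set ℝ} (hG : IsOpen G) {τ : ℝ × ℝ} (hτ : 0 < τ.1)
    (hτG : contr τ ∈ G) :
    ∃ δ > 0, ∀ σ : ℝ × ℝ, |σ.1 - τ.1| < δ → |σ.2 - τ.2| < δ → contr σ ∈ G := by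
  have hU : IsOpen {τ : ℝ × ℝ | 0 < τ.1} := isOpen_lt continuous_const continuous_fst
  have hc : ContinuousAt contr τ := continuousOn_contr.continuousAt (hU.mem_nhds hτ)
  obtain ⟨δ, hδ, h⟩ := Metric.mem_nhds_iff.1 (hc.preimage_mem_nhds (hG.mem_nhds hτG))
  refine ⟨δ, hδ, fun σ h1 h2 => h ?_⟩
  rw [Metric.mem_ball, Prod.dist_eq, max_lt_iff, Real.dist_eq, Real.dist_eq]
  exact ⟨h1, h2⟩

lemma legendre2_Phig_nonneg (γ : Measure ℝ) [IsProbabilityMeasure γ] (τ : ℝ × ℝ) :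
    0 ≤ legendre2 (Phig γ) τ := by
  refine le_trans ?_ (le_legendre2 (Phig γ) 0 τ)
  simp [Phig_eq_log_laplace, laplace_zero]

lemma eventually_le_measure_contr (γ : Measure ℝ) [IsProbabilityMeasure γ] {G : Set ℝ}
    (hG : IsOpen G) {τ : ℝ × ℝ} (hτ : 0 < τ.1) (hτG : contr τ ∈ G) {α : ℝ}
    (hα : legendre2 (Phig γ) τ < α) :
    ∀ᶠ n : ℕ in atTop, 2⁻¹ * ENNReal.ofReal (Real.exp (-(n * α))) ≤
      Measure.pi (fun _ : Fin n => pairLaw γ) {ω | contr (avgPair ω) ∈ G} := by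
  by_cases hb : ∃ b : ℝ, 0 ≤ b ∧ τ.2 ^ 2 < b ^ 2 * τ.1 ∧ γ {x | b ≤ |x|} ≠ 0
  · obtain ⟨b, hb0, hb, hγb⟩ := hb
    obtain ⟨β, hβ, hβα⟩ := EReal.exists_between_coe_real hα
    rw [EReal.coe_lt_coe_iff] at hβα
    obtain ⟨M, hM0, hM⟩ := exists_truncation γ hτ hb0 hb hγb hβ
    set S := Icc (-(M : ℝ)) M
    obtain ⟨t, htop, hmin⟩ := exists_forall_tiltedLaplace_le (γ.restrict S) hτ hb0 hb hM0
    obtain ⟨δ₁, hδ₁, hbox⟩ := exists_box_subset_contr hG hτ hτG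
    set A := |t.1| + |t.2|
    have hA : 0 ≤ A := by positivity
    set δ := min δ₁ ((α - β) / (A + 1))
    have hδ : 0 < δ := lt_min hδ₁ (div_pos (by linarith) (by linarith))
    have hδA : δ * A ≤ α - β := by
      calc δ * A ≤ (α - β) / (A + 1) * (A + 1) := by
            refine mul_le_mul (min_le_right _ _) (by linarith) hA ?_
            exact div_nonneg (by linarith) (by linarith)
        _ = α - β := div_mul_cancel₀ _ (by linarith)
    have hS0 : γ.restrict S ≠ 0 := by
      intro h0
      rw [h0] at hM0
      simp at hM0
    filter_upwards [eventually_le_measure_near γ measurableSet_Icc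
      (fun x hx => abs_le.2 hx) hS0 htop hmin hδ] with n hn
    refine le_trans ?_ (hn.trans (measure_mono fun ω hω => ?_))
    · calc 2⁻¹ * ENNReal.ofReal (Real.exp (-(n * α)))
          ≤ 2⁻¹ * ENNReal.ofReal (Real.exp (n * (-β) + -(n * (δ * A)))) := by
            gcongr
            have := mul_le_mul_of_nonneg_left hδA (Nat.cast_nonneg (α := ℝ) n)
            linarith
        _ = 2⁻¹ * ENNReal.ofReal (Real.exp (-β)) ^ n *
            ENNReal.ofReal (Real.exp (-(n * (δ * A)))) := by
            rw [Real.exp_add, Real.exp_nat_mul, ENNReal.ofReal_mul (by positivity),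
              ENNReal.ofReal_pow (Real.exp_pos _).le, mul_assoc]
        _ ≤ _ := by
            gcongr
            exact (hM t).le
    · exact hbox _ (hω.1.trans_le (min_le_left _ _)) (hω.2.trans_le (min_le_left _ _))
  · push Not at hb
    have hae := ae_sq_mul_le γ hτ hb
    have hτ2 : τ.2 = 0 := by
      by_contra h
      rw [legendre2_eq_top_of_ae_le γ hτ h hae] at hα
      exact not_top_lt hα
    have hx0 : ∀ᵐ x ∂γ, x = 0 := by
      filter_upwards [hae] with x hx
      rw [hτ2] at hx
      by_contra h
      have : 0 < x ^ 2 * τ.1 := by positivity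
      linarith
    have hG0 : (0 : ℝ) ∈ G := by simpa [contr, hτ2] using hτG
    have hα0 : 0 ≤ α := by
      have := (legendre2_Phig_nonneg γ τ).trans_lt hα
      exact_mod_cast this.le
    refine Eventually.of_forall fun n => ?_
    have hy : ∀ᵐ y ∂(pairLaw γ), y.1 = 0 :=
      (Measure.quasiMeasurePreserving_fst (μ := γ) (ν := gaussianReal 0 1)).ae hx0
    have hω : ∀ᵐ ω ∂(Measure.pi fun _ : Fin n => pairLaw γ), contr (avgPair ω) ∈ G := by
      have hall : ∀ᵐ ω ∂(Measure.pi fun _ : Fin n => pairLaw γ), ∀ i, (ω i).1 = 0 :=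
        ae_all_iff.2 fun i =>
          (Measure.quasiMeasurePreserving_eval (fun _ : Fin n => pairLaw γ) i).ae hy
      filter_upwards [hall] with ω h
      simpa [contr, avgPair, h] using hG0
    have h1 : Measure.pi (fun _ : Fin n => pairLaw γ) {ω | contr (avgPair ω) ∈ G} = 1 := by
      rw [← measure_univ (μ := Measure.pi fun _ : Fin n => pairLaw γ)]
      refine measure_congr ?_
      filter_upwards [hω] with ω h
      exact propext ⟨fun _ => trivial, fun _ => h⟩
    rw [h1]
    calc _ ≤ (1 : ℝ≥0∞) * 1 := by
          gcongr
          · simp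
          · rw [← ENNReal.ofReal_one]
            refine ENNReal.ofReal_le_ofReal (Real.exp_le_one_iff.2 ?_)
            have : 0 ≤ n * α := by positivity
            linarith
      _ = 1 := one_mul 1

/-- Exponential lower bounds on probabilities bound the normalized logarithmic liminf. -/
lemma le_liminf_log {u : ℕ → ℝ≥0∞} {α : ℝ}
    (h : ∀ᶠ n : ℕ in atTop, 2⁻¹ * ENNReal.ofReal (Real.exp (-(n * α))) ≤ u n) :
    ((-α : ℝ) : EReal) ≤
      atTop.liminf fun n : ℕ => (((n : ℝ)⁻¹ : ℝ) : EReal) * ENNReal.log (u n) := by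
  have hbd : ∀ᶠ n : ℕ in atTop, (((n : ℝ)⁻¹ * Real.log 2⁻¹ - α : ℝ) : EReal) ≤
      (((n : ℝ)⁻¹ : ℝ) : EReal) * ENNReal.log (u n) := by
    filter_upwards [h, eventually_gt_atTop 0] with n hu hn
    have hn' : (0 : ℝ) < n := by exact_mod_cast hn
    have h1 : ENNReal.ofReal (2⁻¹ * Real.exp (-(n * α))) ≤ u n := by
      refine le_trans (le_of_eq ?_) hu
      rw [ENNReal.ofReal_mul (by positivity), ENNReal.ofReal_inv_of_pos (by norm_num),
        ENNReal.ofReal_ofNat]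
    have h2 : ((Real.log 2⁻¹ - n * α : ℝ) : EReal) ≤ ENNReal.log (u n) := by
      refine le_trans (le_of_eq ?_) (ENNReal.log_monotone h1)
      rw [ENNReal.log_ofReal_of_pos (by positivity), Real.log_mul (by positivity) (by positivity),
        Real.log_exp, sub_eq_add_neg]
    calc _ = (((n : ℝ)⁻¹ : ℝ) : EReal) * ((Real.log 2⁻¹ - n * α : ℝ) : EReal) := by
          rw [← EReal.coe_mul]
          congr 1
          field_simp
      _ ≤ _ := mul_le_mul_of_nonneg_left h2 (by exact_mod_cast (inv_pos.2 hn').le)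
  have hlim : Tendsto (fun n : ℕ => (((n : ℝ)⁻¹ * Real.log 2⁻¹ - α : ℝ) : EReal)) atTop
      (𝓝 ((-α : ℝ) : EReal)) := by
    refine (continuous_coe_real_ereal.tendsto _).comp ?_
    have := ((tendsto_inv_atTop_nhds_zero_nat (𝕜 := ℝ)).mul_const (Real.log 2⁻¹)).sub_const α
    simpa using this
  rw [← hlim.liminf_eq]
  exact liminf_le_liminf hbd

lemma neg_iInf_Iag_le_liminf (γ : Measure ℝ) [IsProbabilityMeasure γ] {G : Set ℝ} (hG : IsOpen G)
    {u : ℕ → ℝ≥0∞} (hu : ∀ n : ℕ, 0 < n → u n =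
      Measure.pi (fun _ : Fin n => pairLaw γ) {ω | contr (avgPair ω) ∈ G}) :
    -(⨅ x ∈ G, Iag γ x) ≤
      atTop.liminf fun n : ℕ => (((n : ℝ)⁻¹ : ℝ) : EReal) * ENNReal.log (u n) := by
  rw [EReal.neg_le]
  refine le_iInf₂ fun x hx => le_iInf₂ fun τ hτ => ?_
  refine EReal.le_of_forall_lt_iff_le.1 fun α hα => ?_
  rw [EReal.neg_le, ← EReal.coe_neg]
  refine le_liminf_log ?_
  have hτG : contr τ ∈ G := by
    have : contr τ = x := hτ.2
    rwa [this]
  filter_upwards [eventually_le_measure_contr γ hG hτ.1 hτG hα, eventually_gt_atTop 0] with n h hn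
  rwa [hu n hn]

lemma limsup_le_neg_iInf_Iag (γ : Measure ℝ) [IsProbabilityMeasure γ] (hγ : memT 2 γ) {F : Set ℝ}
    (hF : IsClosed F) {u : ℕ → ℝ≥0∞} (hu : ∀ n : ℕ, 0 < n → u n =
      Measure.pi (fun _ : Fin n => pairLaw γ) {ω | contr (avgPair ω) ∈ F}) :
    (atTop.limsup fun n : ℕ => (((n : ℝ)⁻¹ : ℝ) : EReal) * ENNReal.log (u n)) ≤
      -(⨅ x ∈ F, Iag γ x) := by
  rw [EReal.le_neg]
  refine EReal.ge_of_forall_gt_iff_ge.1 fun α hα => ?_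
  rw [EReal.le_neg, ← EReal.coe_neg]
  obtain ⟨K, hK⟩ := exists_measure_contr_le γ hγ hF fun w hw => hα.trans_le (iInf₂_le w hw)
  refine limsup_log_le (K := K) fun n hn => ?_
  rw [hu n hn]
  exact hK n hn

end LDP

/-- Annealed LDP for product measures `γ ∈ 𝒯₂`. -/
theorem statement10
    (γ : Measure ℝ) [IsProbabilityMeasure γ] (hγ : memT 2 γ)
    {Ω : Type*} [MeasurableSpace Ω] (P : Measure Ω) [IsProbabilityMeasure P]
    (X Θ : (n : ℕ) → Ω → (Fin n → ℝ))
    (hXmeas : ∀ n, Measurable (X n)) (hΘmeas : ∀ n, Measurable (Θ n))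
    (hX : ∀ n, Measure.map (X n) P = Measure.pi (fun _ : Fin n => γ))
    (hΘ : ∀ n, 0 < n → IsUniformSphere (Measure.map (Θ n) P))
    (hIndep : ∀ n, IndepFun (X n) (Θ n) P) :
    IsLDP P (fun n ω => (n : ℝ) ^ (-(1:ℝ)/2) * dotp (X n ω) (Θ n ω))
      (fun n => (n : ℝ)) (Iag γ)
    ∧ QuasiconvexRate (Iag γ)
    ∧ HasCompactSublevels (Iag γ) := by
  refine ⟨⟨lowerSemicontinuous_Iag hγ, fun Γ _ => ⟨?_, ?_⟩⟩, quasiconvexRate_Iag hγ,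
    hasCompactSublevels_Iag hγ⟩
  · exact neg_iInf_Iag_le_liminf γ isOpen_interior fun n hn =>
      measure_dotp_mem hn (hXmeas n) (hΘmeas n) (hX n) (hΘ n hn) (hIndep n)
        isOpen_interior.measurableSet
  · exact limsup_le_neg_iInf_Iag γ hγ isClosed_closure fun n hn =>
      measure_dotp_mem hn (hXmeas n) (hΘmeas n) (hX n) (hΘ n hn) (hIndep n)
        isClosed_closure.measurableSet
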